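/- arXiv:1201.5994 — 2 statements merged into one kernel-verified Lean document; each statement's English description precedes it below -/
import Mathlib

section
/- Let L (of size r, with first element ℓ_0), D (of size k − 1 − r) and Ω (of size t + 2) be pairwise disjoint ordered subsequences of S. If 1 ≤ r ≤ t + 2 and r ≤ p − 1, then 0 = ∑_{Δ ⊆ Ω, |Δ| = r} P_D(Δ, L) ∏_{z ∈ (Ω \ Δ) ∪ (L \ {ℓ_0})} det(z, Δ, D)^{−1}, where each Δ carries the order induced from Ω. -/
/-- `detCols L` is the determinant of the `k × k` matrix whose `j`-th column is the
`j`-th entry of the list `L` (lists of length ≠ `k` are padded with `0`). -/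
def detCols {F : Type} [CommRing F] {k : ℕ} (L : List (Fin k → F)) : F :=
  Matrix.det (Matrix.of fun i j : Fin k => L.getD (j : ℕ) 0 i)

/-- The Segre product `P_D(A, B)` of the sequences `A = (a_1, …, a_n)` and
`B = (b_0, …, b_{n−1})` with base `D`, with respect to the family of tangent functions `T`:
`∏_{i=1}^n T_{D ∪ {a_1,…,a_{i−1},b_i,…,b_{n−1}}}(a_i) ·
  T_{D ∪ {a_1,…,a_{i−1},b_i,…,b_{n−1}}}(b_{i−1})⁻¹`. -/
def segreP {F : Type} [Field F] [DecidableEq F] {k : ℕ}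
    (T : Finset (Fin k → F) → (Fin k → F) → F)
    (D : Finset (Fin k → F)) (A B : List (Fin k → F)) : F :=
  ∏ j ∈ Finset.range A.length,
    (T (D ∪ (A.take j).toFinset ∪ (B.drop (j + 1)).toFinset) (A.getD j 0) *
      (T (D ∪ (A.take j).toFinset ∪ (B.drop (j + 1)).toFinset) (B.getD j 0))⁻¹)

/-- `T` is a family of tangent functions for `S` (with `t` tangent hyperplanes through
each subset of size `k − 2`): for every `Y ⊆ S` with `|Y| = k − 2` there is a set `Φ` of
`t` pairwise linearly independent linear forms, each vanishing on `Y` and nonzero at every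
vector of `S \ Y`, with `T Y = ∏_{α ∈ Φ} α`. -/
def IsTangentFamily {F : Type} [Field F] [DecidableEq F] {k : ℕ} (t : ℕ)
    (S : Finset (Fin k → F)) (T : Finset (Fin k → F) → (Fin k → F) → F) : Prop :=
  ∀ Y : Finset (Fin k → F), Y ⊆ S → Y.card = k - 2 →
    ∃ Φ : Finset ((Fin k → F) →ₗ[F] F),
      Φ.card = t ∧
      (∀ α ∈ Φ, ∀ β ∈ Φ, α ≠ β → ∀ c : F, α ≠ c • β) ∧
      (∀ α ∈ Φ, ∀ y ∈ Y, α y = 0) ∧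
      (∀ α ∈ Φ, ∀ s ∈ S, s ∉ Y → α s ≠ 0) ∧
      (∀ x, T Y x = ∏ α ∈ Φ, α x)

/-- The subsequence of `L` consisting of the entries whose positions lie in `s`,
in their original order (`d` is a default value). -/
def subseq {α : Type} (d : α) (L : List α) (s : Finset ℕ) : List α :=
  ((List.range L.length).filter (fun i => decide (i ∈ s))).map (fun i => L.getD i d)

/-- The subsequence of `L` consisting of the entries whose positions do not lie in `s`,
in their original order (`d` is a default value). -/
def subseqC {α : Type} (d : α) (L : List α) (s : Finset ℕ) : List α :=
  ((List.range L.length).filter (fun i => decide (i ∉ s))).map (fun i => L.getD i d)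

/-- The number of transpositions needed (counted as the number of inversions) to reorder a
list of length `len` so that the entries in positions `s` occupy the last `|s|` positions,
preserving the relative order of the two groups. -/
def invCount (s : Finset ℕ) (len : ℕ) : ℕ :=
  ((Finset.range len ×ˢ Finset.range len).filter
    (fun ij => ij.1 ∈ s ∧ ij.2 ∉ s ∧ ij.1 < ij.2)).card

section Determinants

variable {F : Type} [Field F] {k : ℕ}

theorem detCols_eq_detRowAlternating (L : List (Fin k → F)) :
    detCols L = Matrix.detRowAlternating (fun j : Fin k => L.getD (j : ℕ) 0) :=
  (Matrix.det_transpose _).symm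

theorem detCols_swap (P Q : List (Fin k → F)) (x y : Fin k → F)
    (h : P.length + 2 + Q.length = k) :
    detCols (P ++ x :: y :: Q) = -detCols (P ++ y :: x :: Q) := by
  rw [detCols_eq_detRowAlternating, detCols_eq_detRowAlternating]
  let i : Fin k := ⟨P.length, by omega⟩
  let j : Fin k := ⟨P.length + 1, by omega⟩
  have hij : i ≠ j := by simp [i, j, Fin.ext_iff]
  rw [← AlternatingMap.map_swap _ _ hij]
  congr 1
  funext l
  simp only [Function.comp_apply]
  rcases lt_trichotomy (l : ℕ) P.length with hl | hl | hl
  · rw [Equiv.swap_apply_of_ne_of_ne (by simp [i, Fin.ext_iff]; omega)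
      (by simp [j, Fin.ext_iff]; omega), List.getD_append _ _ _ _ hl, List.getD_append _ _ _ _ hl]
  · have : l = i := Fin.ext hl
    subst this
    rw [Equiv.swap_apply_left, List.getD_append_right _ _ _ _ (by simp [i]),
      List.getD_append_right _ _ _ _ (by simp [j])]
    simp [i, j]
  · by_cases hl' : (l : ℕ) = P.length + 1
    · have : l = j := Fin.ext hl'
      subst this
      rw [Equiv.swap_apply_right, List.getD_append_right _ _ _ _ (by simp [j]),
        List.getD_append_right _ _ _ _ (by simp [i])]
      simp [i, j]
    · rw [Equiv.swap_apply_of_ne_of_ne (by simp [i, Fin.ext_iff]; omega)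
        (by simp [j, Fin.ext_iff]; omega), List.getD_append_right _ _ _ _ hl.le,
        List.getD_append_right _ _ _ _ hl.le]
      obtain ⟨c, hc⟩ := Nat.exists_eq_add_of_le (show 2 ≤ (l : ℕ) - P.length by omega)
      rw [hc, add_comm 2 c]
      simp

theorem detCols_move (P A Q : List (Fin k → F)) (x : Fin k → F)
    (h : P.length + 1 + A.length + Q.length = k) :
    detCols (P ++ x :: (A ++ Q)) = (-1) ^ A.length * detCols (P ++ (A ++ x :: Q)) := by
  induction A generalizing P with
  | nil => simp
  | cons a A ih =>
    have h1 := ih (P ++ [a]) (by simp at h ⊢; omega)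
    have h2 := detCols_swap P (A ++ Q) x a (by simp at h ⊢; omega)
    simp only [List.cons_append, List.append_assoc, List.nil_append, List.length_cons] at *
    rw [h2, h1]
    ring

theorem detCols_exchange (P A Q : List (Fin k → F)) (x y : Fin k → F)
    (h : P.length + 2 + A.length + Q.length = k) :
    detCols (P ++ x :: (A ++ y :: Q)) = -detCols (P ++ y :: (A ++ x :: Q)) := by
  have h1 := detCols_move P A (y :: Q) x (by simp; omega)
  have h2 := detCols_move P A (x :: Q) y (by simp; omega)
  have h3 := detCols_swap (P ++ A) Q x y (by simp; omega)
  simp only [List.append_assoc] at h3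
  rw [h1, h2, h3]
  ring

/-- The linear form `z ↦ det(z, Y)`. -/
theorem exists_linear_detCols (hk : 0 < k) (Y : List (Fin k → F)) :
    ∃ f : (Fin k → F) →ₗ[F] F, ∀ z, f z = detCols (z :: Y) := by
  refine ⟨Matrix.detRowAlternating.toMultilinearMap.toLinearMap
    (fun j : Fin k => ((0 : Fin k → F) :: Y).getD (j : ℕ) 0) ⟨0, hk⟩, fun z => ?_⟩
  rw [detCols_eq_detRowAlternating]
  change Matrix.detRowAlternating _ = _
  congr 1
  funext j
  by_cases hj : j = ⟨0, hk⟩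
  · subst hj; simp
  · obtain ⟨c, hc⟩ := Nat.exists_eq_succ_of_ne_zero (n := (j : ℕ)) (by
      intro h; exact hj (Fin.ext h))
    rw [Function.update_of_ne hj, hc]
    simp

theorem detCols_eq_zero_of_mem (hk : 0 < k) {Y : List (Fin k → F)} (hY : Y.length + 1 = k)
    {z : Fin k → F} (hz : z ∈ Y) : detCols (z :: Y) = 0 := by
  obtain ⟨n, hn, rfl⟩ := List.getElem_of_mem hz
  rw [detCols_eq_detRowAlternating]
  refine AlternatingMap.map_eq_zero_of_eq _ _ (i := ⟨0, hk⟩) (j := ⟨n + 1, by omega⟩) ?_ ?_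
  · simp [hn]
  · simp [Fin.ext_iff]

/-- Every subset of `S` of size `k` is a basis of `F ^ k`. -/
def IsArc (S : Finset (Fin k → F)) : Prop :=
  ∀ A ⊆ S, A.card = k →
    LinearIndependent F (fun v : {x // x ∈ A} => (v : Fin k → F)) ∧
    Submodule.span F (A : Set (Fin k → F)) = ⊤

variable [DecidableEq F]

theorem IsArc.detCols_ne_zero {S : Finset (Fin k → F)} (hS : IsArc S) {L : List (Fin k → F)}
    (hL : L.length = k) (hnd : L.Nodup) (hLS : ∀ v ∈ L, v ∈ S) : detCols L ≠ 0 := by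
  have hli := (hS L.toFinset (fun v hv => hLS v (List.mem_toFinset.1 hv))
    (by rw [List.toFinset_card_of_nodup hnd, hL])).1
  have hmem (j : Fin k) : L.getD (j : ℕ) 0 ∈ L.toFinset := by
    rw [List.mem_toFinset, List.getD_eq_getElem _ _ (by omega)]
    exact List.getElem_mem _
  have hinj : Function.Injective
      (fun j : Fin k => (⟨L.getD (j : ℕ) 0, hmem j⟩ : {x // x ∈ L.toFinset})) := by
    intro i j hij
    simp only [Subtype.mk.injEq] at hij
    rw [List.getD_eq_getElem _ _ (by omega), List.getD_eq_getElem _ _ (by omega)] at hij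
    exact Fin.ext ((hnd.getElem_inj_iff).1 hij)
  have := hli.comp _ hinj
  have hu := (Matrix.linearIndependent_rows_iff_isUnit
    (A := Matrix.of fun j : Fin k => L.getD (j : ℕ) 0)).1 this
  rw [Matrix.isUnit_iff_isUnit_det] at hu
  rw [detCols_eq_detRowAlternating]
  exact hu.ne_zero

/-- Cramer's rule modulo the span of `Y`. -/
theorem IsArc.cramer {S : Finset (Fin k → F)} (hS : IsArc S) {Y : List (Fin k → F)}
    {a b : Fin k → F} (hY : Y.length + 2 = k) (hnd : (a :: b :: Y).Nodup)
    (hYS : ∀ v ∈ a :: b :: Y, v ∈ S) {α : (Fin k → F) →ₗ[F] F} (hα : ∀ y ∈ Y, α y = 0)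
    (x : Fin k → F) :
    α x * detCols (a :: b :: Y) =
      α a * detCols (x :: b :: Y) + α b * detCols (a :: x :: Y) := by
  have hk : 0 < k := by omega
  obtain ⟨f, hf⟩ := exists_linear_detCols hk (b :: Y)
  obtain ⟨g, hg⟩ := exists_linear_detCols hk (a :: Y)
  have hspan := (hS (a :: b :: Y).toFinset (fun v hv => hYS v (List.mem_toFinset.1 hv))
    (by rw [List.toFinset_card_of_nodup hnd]; simp; omega)).2
  have hsw (u v : Fin k → F) : detCols (u :: v :: Y) = -detCols (v :: u :: Y) :=
    detCols_swap [] Y u v (by simp; omega)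
  have key : detCols (a :: b :: Y) • α = α a • f - α b • g := by
    refine LinearMap.ext_on hspan fun v hv => ?_
    have hv' : v ∈ a :: b :: Y := List.mem_toFinset.1 (Finset.mem_coe.1 hv)
    simp only [LinearMap.smul_apply, LinearMap.sub_apply, hf, hg, smul_eq_mul]
    have hz (u : Fin k → F) (h : v ∈ u :: Y) : detCols (v :: u :: Y) = 0 :=
      detCols_eq_zero_of_mem hk (by simp; omega) h
    rcases List.mem_cons.1 hv' with rfl | h
    · rw [hz v (by simp)]; ring
    rcases List.mem_cons.1 h with rfl | h
    · rw [hz v (by simp), hsw a v]; ring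
    · rw [hz b (by simp [h]), hz a (by simp [h]), hα v h]; ring
  have := LinearMap.congr_fun key x
  simp only [LinearMap.smul_apply, LinearMap.sub_apply, hf, hg, smul_eq_mul] at this
  rw [hsw a x]
  linear_combination this

end Determinants

section Segre

/-- Lagrange interpolation for a product of linear forms in two variables, where `d` plays the
role of the `2 × 2` determinant. -/
theorem sum_prod_mul_prod_inv_eq_zero {F ι V : Type*} [Field F] [DecidableEq V] [DecidableEq ι]
    (d : V → V → F) (I : Finset ι) (f : ι → V → F) (E : Finset V) (hE : E.card = I.card + 2)
    (hself : ∀ a, d a a = 0) (hanti : ∀ a b, d a b = -d b a)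
    (hne : ∀ a ∈ E, ∀ b ∈ E, a ≠ b → d a b ≠ 0)
    (hcr : ∀ i ∈ I, ∀ a ∈ E, ∀ b ∈ E, ∀ x ∈ E, a ≠ b →
      f i x * d a b = f i a * d x b + f i b * d a x) :
    ∑ e ∈ E, (∏ i ∈ I, f i e) * ∏ z ∈ E.erase e, (d z e)⁻¹ = 0 := by
  induction I using Finset.induction_on generalizing E with
  | empty =>
    obtain ⟨a, b, hab, rfl⟩ := Finset.card_eq_two.1 (by simpa using hE)
    rw [Finset.sum_pair hab]
    have h1 : ({a, b} : Finset V).erase a = {b} := by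
      ext x; simp only [Finset.mem_erase, Finset.mem_insert, Finset.mem_singleton]; grind
    have h2 : ({a, b} : Finset V).erase b = {a} := by
      ext x; simp only [Finset.mem_erase, Finset.mem_insert, Finset.mem_singleton]; grind
    rw [h1, h2, Finset.prod_singleton, Finset.prod_singleton, hanti b a]
    simp [inv_neg]
  | insert i I hi ih =>
    rw [Finset.card_insert_of_notMem hi] at hE
    obtain ⟨a, ha, b, hb, hab⟩ := Finset.one_lt_card.1 (show 1 < E.card by omega)
    have key : ∀ c ∈ E,
        ∑ e ∈ E, d c e * ((∏ j ∈ I, f j e) * ∏ z ∈ E.erase e, (d z e)⁻¹) = 0 := by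
      intro c hc
      have h0 := ih (E.erase c) (by rw [Finset.card_erase_of_mem hc]; omega)
        (fun a ha b hb => hne a (Finset.mem_of_mem_erase ha) b (Finset.mem_of_mem_erase hb))
        (fun j hj a ha b hb x hx => hcr j (Finset.mem_insert_of_mem hj) a
          (Finset.mem_of_mem_erase ha) b (Finset.mem_of_mem_erase hb) x
          (Finset.mem_of_mem_erase hx))
      rw [← Finset.add_sum_erase _ _ hc, hself, zero_mul, zero_add, ← h0]
      refine Finset.sum_congr rfl fun e he => ?_
      have hec := Finset.ne_of_mem_erase he
      have hce : c ∈ E.erase e := Finset.mem_erase.2 ⟨hec.symm, hc⟩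
      rw [← Finset.mul_prod_erase _ _ hce, Finset.erase_right_comm]
      have := hne c hc e (Finset.mem_of_mem_erase he) hec.symm
      field_simp
    have hd := hne a ha b hb hab
    refine (mul_eq_zero.1 ?_).resolve_left hd
    have h1 := key a ha
    have h2 := key b hb
    calc _ = ∑ e ∈ E, (f i b * (d a e * ((∏ j ∈ I, f j e) * ∏ z ∈ E.erase e, (d z e)⁻¹))
            - f i a * (d b e * ((∏ j ∈ I, f j e) * ∏ z ∈ E.erase e, (d z e)⁻¹))) := by
          rw [Finset.mul_sum]
          refine Finset.sum_congr rfl fun e he => ?_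
          rw [Finset.prod_insert hi]
          have := hcr i (Finset.mem_insert_self _ _) a ha b hb e he hab
          rw [hanti e b] at this
          linear_combination ((∏ j ∈ I, f j e) * ∏ z ∈ E.erase e, (d z e)⁻¹) * this
      _ = 0 := by
          rw [Finset.sum_sub_distrib, ← Finset.mul_sum, ← Finset.mul_sum, h1, h2]; simp

theorem FiniteField.prod_erase_zero_eq_neg_one (F : Type*) [Field F] [Fintype F]
    [DecidableEq F] : ∏ x ∈ Finset.univ.erase (0 : F), x = -1 := by
  have h : ((∏ x : Fˣ, x : Fˣ) : F) = -1 := by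
    rw [FiniteField.prod_univ_units_id_eq_neg_one, Units.val_neg, Units.val_one]
  rw [Units.coe_prod] at h
  rw [← h]
  symm
  refine Finset.prod_bij (fun u _ => (u : F)) ?_ ?_ ?_ ?_
  · simp
  · intro a _ b _ hab; exact Units.ext hab
  · intro b hb; exact ⟨Units.mk0 b (Finset.ne_of_mem_erase hb), Finset.mem_univ _, rfl⟩
  · simp

variable {F : Type} [Field F] [DecidableEq F] {k t : ℕ} {S : Finset (Fin k → F)}
  {T : Finset (Fin k → F) → (Fin k → F) → F}

theorem IsTangentFamily.ne_zero (hT : IsTangentFamily t S T) {Y : Finset (Fin k → F)}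
    (hY : Y ⊆ S) (hc : Y.card = k - 2) {s : Fin k → F} (hs : s ∈ S) (hsY : s ∉ Y) :
    T Y s ≠ 0 := by
  obtain ⟨Φ, -, -, -, h, hp⟩ := hT Y hY hc
  rw [hp]
  exact Finset.prod_ne_zero_iff.2 fun α hα => h α hα s hs hsY

theorem IsTangentFamily.interpolation (hS : IsArc S) (hT : IsTangentFamily t S T)
    {D : List (Fin k → F)} (hD : D.length + 2 = k) (hnd : D.Nodup) (hDS : ∀ v ∈ D, v ∈ S)
    {E : Finset (Fin k → F)} (hE : E.card = t + 2) (hES : E ⊆ S) (hdisj : ∀ v ∈ E, v ∉ D) :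
    ∑ e ∈ E, T D.toFinset e * ∏ z ∈ E.erase e, (detCols (z :: e :: D))⁻¹ = 0 := by
  classical
  obtain ⟨Φ, hΦ, -, hv, -, hp⟩ := hT D.toFinset (fun v hv => hDS v (List.mem_toFinset.1 hv))
    (by rw [List.toFinset_card_of_nodup hnd]; omega)
  have hv' : ∀ α ∈ Φ, ∀ y ∈ D, α y = 0 := fun α hα y hy => hv α hα y (List.mem_toFinset.2 hy)
  simp only [hp]
  have hnd' : ∀ a ∈ E, ∀ b ∈ E, a ≠ b → (a :: b :: D).Nodup := by
    intro a ha b hb hab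
    simp [hab, hnd, hdisj a ha, hdisj b hb]
  have hS' : ∀ a ∈ E, ∀ b ∈ E, ∀ v ∈ a :: b :: D, v ∈ S := by
    intro a ha b hb v hv
    simp only [List.mem_cons] at hv
    rcases hv with rfl | rfl | hv
    exacts [hES ha, hES hb, hDS v hv]
  refine sum_prod_mul_prod_inv_eq_zero (fun a b => detCols (a :: b :: D)) Φ
    (fun α x => α x) E (by omega) ?_ ?_ ?_ ?_
  · exact fun a => detCols_eq_zero_of_mem (by omega) (by simp; omega) (by simp)
  · exact fun a b => detCols_swap [] D a b (by simp; omega)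
  · exact fun a ha b hb hab => hS.detCols_ne_zero (by simp; omega) (hnd' a ha b hb hab)
      (hS' a ha b hb)
  · exact fun α hα a ha b hb x _ hab => hS.cramer hD (hnd' a ha b hb hab) (hS' a ha b hb)
      (hv' α hα) x

variable [Fintype F]

/-- The hyperplanes through `Y` meeting the line `⟨y, z⟩` outside `y` and `z` are exactly the
tangent hyperplanes and those through one further point of `S`. -/
theorem IsTangentFamily.prod_det_div_mul_div (hS : IsArc S) (hT : IsTangentFamily t S T)
    (ht : S.card + t = Fintype.card F + k - 1) {Y : List (Fin k → F)} (hY : Y.length + 2 = k)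
    {y z : Fin k → F} (hnd : (y :: z :: Y).Nodup) (hYS : ∀ v ∈ y :: z :: Y, v ∈ S) :
    (∏ s ∈ S \ (y :: z :: Y).toFinset, detCols (y :: s :: Y) / detCols (s :: z :: Y)) *
      ((-1) ^ t * (T Y.toFinset y / T Y.toFinset z)) = -1 := by
  classical
  have hk : 0 < k := by omega
  have hnd3 := hnd
  simp only [List.nodup_cons, List.mem_cons, not_or] at hnd3
  obtain ⟨⟨hyz, hyY⟩, hzY, hYn⟩ := hnd3
  have hyS : y ∈ S := hYS y (by simp)
  have hzS : z ∈ S := hYS z (by simp)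
  have hYS' : ∀ v ∈ Y, v ∈ S := fun v hv => hYS v (by simp [hv])
  have hsub : Y.toFinset ⊆ S := fun v hv => hYS' v (List.mem_toFinset.1 hv)
  obtain ⟨Φ, hΦ, hind, hv, hnz, hp⟩ := hT Y.toFinset hsub
    (by rw [List.toFinset_card_of_nodup hYn]; omega)
  have hv' : ∀ α ∈ Φ, ∀ y ∈ Y, α y = 0 := fun α hα y hy => hv α hα y (List.mem_toFinset.2 hy)
  have hα_ne : ∀ α ∈ Φ, ∀ s ∈ S, s ∉ Y → α s ≠ 0 := fun α hα s hs hsY =>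
    hnz α hα s hs (by simpa using hsY)
  set R := S \ (y :: z :: Y).toFinset with hR
  have hRmem : ∀ s ∈ R, s ∈ S ∧ s ≠ y ∧ s ≠ z ∧ s ∉ Y := by
    intro s hs
    simpa [hR] using hs
  let d : (Fin k → F) → (Fin k → F) → F := fun a b => detCols (a :: b :: Y)
  have hanti : ∀ a b, d a b = -d b a := fun a b => detCols_swap [] Y a b (by simp; omega)
  have hdne : ∀ a ∈ S, ∀ b ∈ S, a ∉ Y → b ∉ Y → a ≠ b → d a b ≠ 0 := by
    intro a ha b hb haY hbY hab
    refine hS.detCols_ne_zero (by simp; omega) (by simp [*]) ?_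
    intro v hv
    simp only [List.mem_cons] at hv
    rcases hv with rfl | rfl | hv
    exacts [ha, hb, hYS' v hv]
  have hcr : ∀ α : (Fin k → F) →ₗ[F] F, (∀ y ∈ Y, α y = 0) → ∀ x,
      α x * d y z = α y * d x z + α z * d y x := fun α hα x => hS.cramer hY hnd hYS hα x
  have hyz0 := hdne y hyS z hzS hyY hzY hyz
  have hRd : ∀ s ∈ R, d y s ≠ 0 ∧ d s z ≠ 0 := fun s hs => by
    obtain ⟨h1, h2, h3, h4⟩ := hRmem s hs
    exact ⟨hdne y hyS s h1 hyY h4 h2.symm, hdne s h1 z hzS h4 hzY h3⟩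
  let ρ : (Fin k → F) → F := fun s => d y s / d s z
  let σ : ((Fin k → F) →ₗ[F] F) → F := fun α => -(α y / α z)
  have hρ : Set.InjOn ρ R := by
    intro s hs s' hs' h
    by_contra hss
    obtain ⟨h1, h2, h3, h4⟩ := hRmem s hs
    obtain ⟨h1', h2', h3', h4'⟩ := hRmem s' hs'
    have hd := hdne s' h1' s h1 h4' h4 (Ne.symm hss)
    obtain ⟨f, hf⟩ := exists_linear_detCols hk (s :: Y)
    have := hcr f (fun v hv => by
      rw [hf]; exact detCols_eq_zero_of_mem hk (by simp; omega) (by simp [hv])) s'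
    rw [hf, hf, hf] at this
    change d s' s * _ = d y s * _ + d z s * _ at this
    rw [hanti z s] at this
    have h' := (div_eq_div_iff (hRd s hs).2 (hRd s' hs').2).1 h
    exact mul_ne_zero hd hyz0 (by linear_combination this + h')
  have hσ : Set.InjOn σ Φ := by
    intro α hα β hβ h
    by_contra hne
    have hαz := hα_ne α hα z hzS hzY
    have hβz := hα_ne β hβ z hzS hzY
    refine hind α hα β hβ hne (α z / β z) ?_
    refine LinearMap.ext fun x => ?_
    have h' := (div_eq_div_iff hαz hβz).1 (neg_injective h)
    have hy : α y = α z / β z * β y := by field_simp; linear_combination h'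
    have hx : α x = α z / β z * β x := by
      apply mul_right_cancel₀ hyz0
      have e1 := hcr α (hv' α hα) x
      have e2 := hcr β (hv' β hβ) x
      have hz : α z = α z / β z * β z := by field_simp
      linear_combination e1 - α z / β z * e2 + d x z * hy + d y x * hz
    simpa using hx
  have hdisj : Disjoint (R.image ρ) (Φ.image σ) := by
    rw [Finset.disjoint_left]
    intro c hc hc'
    obtain ⟨s, hs, rfl⟩ := Finset.mem_image.1 hc
    obtain ⟨α, hα, h⟩ := Finset.mem_image.1 hc'
    obtain ⟨h1, h2, h3, h4⟩ := hRmem s hs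
    have h5 := hα_ne α hα s h1 h4
    have hαz := hα_ne α hα z hzS hzY
    have e := hcr α (hv' α hα) s
    have h' : -(α y) * d s z = d y s * α z := by
      rw [← div_eq_div_iff hαz (hRd s hs).2, neg_div]; exact h
    exact mul_ne_zero h5 hyz0 (by linear_combination e - h')
  have hRc : R.card + k = S.card := by
    have hsub2 : (y :: z :: Y).toFinset ⊆ S := fun v hv => hYS v (List.mem_toFinset.1 hv)
    have h1 := Finset.card_sdiff_add_card_eq_card hsub2
    rw [List.toFinset_card_of_nodup hnd] at h1
    simp only [List.length_cons] at h1
    rw [hR]; omega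
  have hU : R.image ρ ∪ Φ.image σ = Finset.univ.erase 0 := by
    refine Finset.eq_of_subset_of_card_le ?_ ?_
    · intro c hc
      refine Finset.mem_erase.2 ⟨?_, Finset.mem_univ _⟩
      rcases Finset.mem_union.1 hc with hc | hc
      · obtain ⟨s, hs, rfl⟩ := Finset.mem_image.1 hc
        exact div_ne_zero (hRd s hs).1 (hRd s hs).2
      · obtain ⟨α, hα, rfl⟩ := Finset.mem_image.1 hc
        exact neg_ne_zero.2 (div_ne_zero (hα_ne α hα y hyS hyY) (hα_ne α hα z hzS hzY))
    · rw [Finset.card_union_of_disjoint hdisj, Finset.card_image_of_injOn hρ,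
        Finset.card_image_of_injOn hσ, Finset.card_erase_of_mem (Finset.mem_univ _),
        Finset.card_univ]
      omega
  refine Eq.trans ?_ (FiniteField.prod_erase_zero_eq_neg_one F)
  rw [← hU, Finset.prod_union hdisj,
    Finset.prod_image hρ, Finset.prod_image hσ, hp, hp, ← hΦ, ← Finset.prod_div_distrib,
    ← Finset.prod_const, ← Finset.prod_mul_distrib]
  congr 1
  exact Finset.prod_congr rfl fun α _ => by simp [σ]

/-- Segre's lemma of tangents. -/
theorem IsTangentFamily.segre (hS : IsArc S) (hT : IsTangentFamily t S T)
    (ht : S.card + t = Fintype.card F + k - 1) {D : Finset (Fin k → F)} (hD : D.card + 3 = k)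
    (hDS : D ⊆ S) {x y z : Fin k → F} (hx : x ∈ S) (hy : y ∈ S) (hz : z ∈ S)
    (hxD : x ∉ D) (hyD : y ∉ D) (hzD : z ∉ D) (hxy : x ≠ y) (hyz : y ≠ z) (hzx : z ≠ x) :
    T (insert x D) y * T (insert y D) z * T (insert z D) x =
      (-1) ^ (t + 1) * (T (insert x D) z * T (insert y D) x * T (insert z D) y) := by
  have hlen : D.toList.length + 3 = k := by simpa using hD
  have hins (u : Fin k → F) : (u :: D.toList).toFinset = insert u D := by simp
  have half {x y z : Fin k → F} (hx : x ∈ S) (hy : y ∈ S) (hz : z ∈ S)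
    (hxD : x ∉ D) (hyD : y ∉ D) (hzD : z ∉ D) (hxy : x ≠ y) (hyz : y ≠ z) (hzx : z ≠ x) :=
    hT.prod_det_div_mul_div hS ht (Y := x :: D.toList) (y := y) (z := z) (by simp; omega)
      (by simp [hyz, hxy.symm, hzx, hxD, hyD, hzD, D.nodup_toList]) (by
        intro v hv
        simp only [List.mem_cons, Finset.mem_toList] at hv
        rcases hv with rfl | rfl | rfl | hv
        exacts [hy, hz, hx, hDS hv])
  have hne {x y : Fin k → F} (hx : x ∈ S) (hy : y ∈ S) (hxD : x ∉ D) (hyD : y ∉ D)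
      (hxy : x ≠ y) : T (insert x D) y ≠ 0 :=
    hT.ne_zero (Finset.insert_subset hx hDS) (by rw [Finset.card_insert_of_notMem hxD]; omega) hy
      (by simp [hxy.symm, hyD])
  have h1 := half hx hy hz hxD hyD hzD hxy hyz hzx
  have h2 := half hy hz hx hyD hzD hxD hyz hzx hxy
  have h3 := half hz hx hy hzD hxD hyD hzx hxy hyz
  rw [hins] at h1 h2 h3
  have e2 : (z :: x :: y :: D.toList).toFinset = (y :: z :: x :: D.toList).toFinset := by
    ext v; simp; tauto
  have e3 : (x :: y :: z :: D.toList).toFinset = (y :: z :: x :: D.toList).toFinset := by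
    ext v; simp; tauto
  rw [e2] at h2
  rw [e3] at h3
  set R := S \ (y :: z :: x :: D.toList).toFinset with hR
  have hprod : (∏ s ∈ R, detCols (y :: s :: x :: D.toList) / detCols (s :: z :: x :: D.toList)) *
      (∏ s ∈ R, detCols (z :: s :: y :: D.toList) / detCols (s :: x :: y :: D.toList)) *
      (∏ s ∈ R, detCols (x :: s :: z :: D.toList) / detCols (s :: y :: z :: D.toList)) = 1 := by
    rw [← Finset.prod_mul_distrib, ← Finset.prod_mul_distrib]
    refine Finset.prod_eq_one fun s hs => ?_
    have hs' : s ∈ S ∧ s ≠ y ∧ s ≠ z ∧ s ≠ x ∧ s ∉ D := by simpa [hR] using hs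
    obtain ⟨hsS, hsy, hsz, hsx, hsD⟩ := hs'
    have cyc (a b c : Fin k → F) :
        detCols (a :: b :: c :: D.toList) = detCols (b :: c :: a :: D.toList) := by
      rw [show a :: b :: c :: D.toList = [] ++ a :: ([b, c] ++ D.toList) by simp,
        detCols_move [] [b, c] D.toList a (by simp; omega)]
      simp
    have nz {a b : Fin k → F} (ha : a ∈ S) (hb : b ∈ S) (haD : a ∉ D) (hbD : b ∉ D)
        (hab : a ≠ b) (hsa : s ≠ a) (hsb : s ≠ b) :
        detCols (s :: a :: b :: D.toList) ≠ 0 := by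
      refine hS.detCols_ne_zero (by simp; omega)
        (by simp [hab, hsa, hsb, haD, hbD, hsD, D.nodup_toList]) ?_
      intro v hv
      simp only [List.mem_cons, Finset.mem_toList] at hv
      rcases hv with rfl | rfl | rfl | hv
      exacts [hsS, ha, hb, hDS hv]
    rw [cyc y s x, cyc z s y, cyc x s z]
    have n1 := nz hx hy hxD hyD hxy hsx hsy
    have n2 := nz hy hz hyD hzD hyz hsy hsz
    have n3 := nz hz hx hzD hxD hzx hsz hsx
    field_simp
  have m1 := hne hx hz hxD hzD hzx.symm
  have m2 := hne hy hx hyD hxD hxy.symm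
  have m3 := hne hz hy hzD hyD hyz.symm
  have hmul := congrArg₂ (· * ·) (congrArg₂ (· * ·) h1 h2) h3
  generalize (∏ s ∈ R, detCols (y :: s :: x :: D.toList) / detCols (s :: z :: x :: D.toList)) = p1
    at hmul hprod
  generalize (∏ s ∈ R, detCols (z :: s :: y :: D.toList) / detCols (s :: x :: y :: D.toList)) = p2
    at hmul hprod
  generalize (∏ s ∈ R, detCols (x :: s :: z :: D.toList) / detCols (s :: y :: z :: D.toList)) = p3
    at hmul hprod
  have hsq : ((-1 : F) ^ t) * (-1) ^ t = 1 := by rw [← mul_pow]; simp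
  have hmul' : (p1 * p2 * p3) * ((-1) ^ t * ((-1) ^ t * (-1) ^ t)) *
      (T (insert x D) y * T (insert y D) z * T (insert z D) x /
        (T (insert x D) z * T (insert y D) x * T (insert z D) y)) = -1 := by
    refine Eq.trans ?_ (hmul.trans (by ring))
    simp only [div_eq_mul_inv, mul_inv]
    ring
  rw [hprod, hsq, one_mul, mul_one] at hmul'
  rw [← mul_div_assoc, div_eq_iff (mul_ne_zero (mul_ne_zero m1 m2) m3)] at hmul'
  rw [pow_succ]
  linear_combination (-1) ^ t * hmul' - (T (insert x D) y * T (insert y D) z * T (insert z D) x) * hsq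
end Segre

section SegreConfig

variable {F : Type} {k t : ℕ} {S : Finset (Fin k → F)}

/-- `L`, `D` and `Ω` are pairwise disjoint in `S` and of the appropriate sizes. -/
structure SegreConfig (t : ℕ) (S : Finset (Fin k → F)) (D L : List (Fin k → F))
    (Ω : Finset (Fin k → F)) : Prop where
  length : D.length + L.length + 1 = k
  card : Ω.card = t + 2
  nodup : (L ++ D).Nodup
  mem : ∀ v ∈ L ++ D, v ∈ S
  notMem : ∀ v ∈ L ++ D, v ∉ Ω
  subset : Ω ⊆ S

theorem SegreConfig.move_left {D L : List (Fin k → F)} {a b : Fin k → F}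
    {Ω : Finset (Fin k → F)} (hc : SegreConfig t S D (a :: b :: L) Ω) :
    SegreConfig t S (b :: D) (a :: L) Ω := by
  have hp : (a :: L ++ b :: D).Perm (a :: b :: L ++ D) := by simp
  obtain ⟨h1, h2, h3, h4, h5, h6⟩ := hc
  exact ⟨by simp at h1 ⊢; omega, h2, hp.nodup_iff.2 h3, fun v hv => h4 v (hp.mem_iff.1 hv),
    fun v hv => h5 v (hp.mem_iff.1 hv), h6⟩

variable [DecidableEq F]

theorem SegreConfig.cons_left {D L : List (Fin k → F)} {a b x : Fin k → F}
    {Ω : Finset (Fin k → F)} (hc : SegreConfig t S D (a :: b :: L) Ω) (hx : x ∈ Ω) :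
    SegreConfig t S (x :: D) (a :: L) (insert b (Ω.erase x)) := by
  obtain ⟨h1, h2, h3, h4, h5, h6⟩ := hc
  simp only [List.cons_append, List.nodup_cons, List.mem_append, List.mem_cons, not_or] at h3 h4 h5
  have hne : ∀ v, v ∉ Ω → v ≠ x := fun v hv h => hv (h ▸ hx)
  have hLD : ∀ v, v ∈ L ∨ v ∈ D → v ∉ Ω := fun v hv => h5 v (by tauto)
  have hndx : (x :: (L ++ D)).Nodup :=
    List.nodup_cons.2 ⟨fun h => hLD x (List.mem_append.1 h) hx, h3.2.2⟩
  refine ⟨by simp at h1 ⊢; omega, ?_, ?_, ?_, ?_, ?_⟩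
  · rw [Finset.card_insert_of_notMem (fun h => h5 b (by simp) (Finset.mem_of_mem_erase h)),
      Finset.card_erase_of_mem hx]
    omega
  · rw [List.cons_append, List.nodup_cons]
    refine ⟨?_, (List.perm_middle.nodup_iff).2 hndx⟩
    simp only [List.mem_append, List.mem_cons, not_or]
    exact ⟨h3.1.2.1, hne a (h5 a (by simp)), h3.1.2.2⟩
  · intro v hv
    simp only [List.cons_append, List.mem_append, List.mem_cons] at hv
    by_cases hvx : v = x
    · exact hvx ▸ h6 hx
    · exact h4 v (by tauto)
  · intro v hv h
    simp only [List.cons_append, List.mem_append, List.mem_cons] at hv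
    rcases Finset.mem_insert.1 h with rfl | h
    · have := hne v (h5 v (by simp))
      have hav := h3.1.1
      have := h3.2.1
      grind
    · have hvx := Finset.ne_of_mem_erase h
      exact h5 v (by tauto) (Finset.mem_of_mem_erase h)
  · exact Finset.insert_subset (h4 b (by simp)) ((Finset.erase_subset _ _).trans h6)

theorem SegreConfig.card_union_tail {D L : List (Fin k → F)} {Ω : Finset (Fin k → F)}
    (hc : SegreConfig t S D L Ω) (hL : L ≠ []) {A : List (Fin k → F)} (hA : A.Nodup)
    (hAΩ : ∀ v ∈ A, v ∈ Ω) (hlen : A.length = L.length) :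
    ((Ω \ A.toFinset) ∪ L.tail.toFinset).card = t + 1 := by
  obtain ⟨b, B, rfl⟩ := List.exists_cons_of_ne_nil hL
  have hsub : A.toFinset ⊆ Ω := fun v hv => hAΩ v (List.mem_toFinset.1 hv)
  have hB : B.Nodup := by
    have := hc.nodup
    simp only [List.cons_append, List.nodup_cons] at this
    exact this.2.of_append_left
  rw [Finset.card_union_of_disjoint, List.tail_cons, List.toFinset_card_of_nodup hB]
  · have := Finset.card_sdiff_add_card_eq_card hsub
    rw [List.toFinset_card_of_nodup hA, hc.card] at this
    simp only [List.length_cons] at hlen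
    omega
  · rw [Finset.disjoint_right]
    intro v hv hv'
    exact hc.notMem v (by simp at hv; simp [hv]) (Finset.mem_sdiff.1 hv').1

end SegreConfig

section SegreProduct

variable {F : Type} [Field F] [DecidableEq F] {k t : ℕ} {S : Finset (Fin k → F)}
  {T : Finset (Fin k → F) → (Fin k → F) → F}

theorem segreP_cons (T : Finset (Fin k → F) → (Fin k → F) → F) (D : Finset (Fin k → F))
    (a b : Fin k → F) (A B : List (Fin k → F)) :
    segreP T D (a :: A) (b :: B) =
      T (D ∪ B.toFinset) a * (T (D ∪ B.toFinset) b)⁻¹ * segreP T (insert a D) A B := by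
  simp only [segreP, List.length_cons]
  rw [Finset.prod_range_succ', mul_comm]
  simp [Finset.insert_union]

/-- The summand indexed by the sequence `A` in the identity for `D`, `L` and `Ω`. -/
def segreTerm (T : Finset (Fin k → F) → (Fin k → F) → F) (D L : List (Fin k → F))
    (Ω : Finset (Fin k → F)) (A : List (Fin k → F)) : F :=
  segreP T D.toFinset A L *
    ∏ z ∈ (Ω \ A.toFinset) ∪ L.tail.toFinset, (detCols (z :: (A ++ D)))⁻¹

theorem exists_sign_of_perm [Fintype F] (hS : IsArc S) (hT : IsTangentFamily t S T)
    (ht : S.card + t = Fintype.card F + k - 1) {A A' : List (Fin k → F)} (h : A.Perm A') :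
    ∃ ε : F, ε * ε = 1 ∧
      (∀ P Q : List (Fin k → F), P.length + A.length + Q.length = k →
        detCols (P ++ (A' ++ Q)) = ε * detCols (P ++ (A ++ Q))) ∧
      ∀ (D : Finset (Fin k → F)) (B : List (Fin k → F)), D ⊆ S → D.card + A.length + 1 = k →
        A.length = B.length → (A ++ B).Nodup → (∀ v ∈ A ++ B, v ∈ S ∧ v ∉ D) →
        segreP T D A' B = ε ^ (t + 1) * segreP T D A B := by
  induction h with
  | nil => exact ⟨1, by simp, by simp, by simp⟩
  | @cons x A A' h ih =>
    obtain ⟨ε, h1, h2, h3⟩ := ih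
    refine ⟨ε, h1, fun P Q hl => ?_, fun D B hD hcard hl hnd hm => ?_⟩
    · have := h2 (P ++ [x]) Q (by simp at hl ⊢; omega)
      simpa using this
    · obtain _ | ⟨b, B⟩ := B
      · simp at hl
      have hnd' : x ∉ A ∧ x ∉ B ∧ (A ++ B).Nodup := by
        simp only [List.cons_append, List.nodup_cons, List.mem_append, List.mem_cons,
          not_or] at hnd
        refine ⟨hnd.1.1, hnd.1.2.2, ?_⟩
        exact hnd.2.sublist (List.Sublist.append_left (List.sublist_cons_self b B) A)
      have hx := hm x (by simp)
      rw [segreP_cons, segreP_cons, h3 (insert x D) B (Finset.insert_subset hx.1 hD)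
        (by rw [Finset.card_insert_of_notMem hx.2]; simp at hcard; omega) (by simpa using hl)
        hnd'.2.2]
      · ring
      · intro v hv
        have := hm v (by simp at hv ⊢; tauto)
        refine ⟨this.1, ?_⟩
        rw [Finset.mem_insert, not_or]
        refine ⟨?_, this.2⟩
        rintro rfl
        rcases List.mem_append.1 hv with hv | hv
        exacts [hnd'.1 hv, hnd'.2.1 hv]
  | swap x y A =>
    refine ⟨-1, by ring, fun P Q hl => ?_, fun D B hD hcard hl hnd hm => ?_⟩
    · rw [List.cons_append, List.cons_append, List.cons_append, List.cons_append,
        detCols_swap P (A ++ Q) x y (by simp at hl ⊢; omega)]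
      ring
    · obtain _ | ⟨a, _ | ⟨b, B⟩⟩ := B
      · simp at hl
      · simp at hl
      simp only [List.cons_append, List.nodup_cons, List.mem_append, List.mem_cons, not_or,
        List.nodup_append] at hnd
      obtain ⟨⟨hyx, hyA, hya, hyb, hyB⟩, ⟨hxA, hxa, hxb, hxB⟩, hAn, ⟨⟨hab, haB⟩, hbB, hBn⟩, hdis⟩ :=
        hnd
      simp only [List.cons_append, List.mem_append, List.mem_cons] at hm
      have hy := hm y (by simp)
      have hx := hm x (by simp)
      have hb := hm b (by simp)
      have hB : ∀ v ∈ B, v ∈ S ∧ v ∉ D := fun v hv => hm v (by simp [hv])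
      have hE : (D ∪ B.toFinset).card + 3 = k := by
        rw [Finset.card_union_of_disjoint, List.toFinset_card_of_nodup hBn]
        · simp at hl hcard; omega
        · rw [Finset.disjoint_right]
          exact fun v hv => (hB v (List.mem_toFinset.1 hv)).2
      have hES : D ∪ B.toFinset ⊆ S :=
        Finset.union_subset hD fun v hv => (hB v (List.mem_toFinset.1 hv)).1
      have hyE : y ∉ D ∪ B.toFinset := by simp [hy.2, hyB]
      have hxE : x ∉ D ∪ B.toFinset := by simp [hx.2, hxB]
      have hbE : b ∉ D ∪ B.toFinset := by simp [hb.2, hbB]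
      have hseg := hT.segre hS ht hE hES hb.1 hx.1 hy.1 hbE hxE hyE (Ne.symm hxb) (Ne.symm hyx) hyb
      have ne (u : Fin k → F) (huS : u ∈ S) (hu : u ∉ D ∪ B.toFinset) (hub : b ≠ u) :
          T (insert u (D ∪ B.toFinset)) b ≠ 0 :=
        hT.ne_zero (Finset.insert_subset huS hES)
          (by rw [Finset.card_insert_of_notMem hu]; omega) hb.1
          (by rw [Finset.mem_insert, not_or]; exact ⟨hub, hbE⟩)
      have n1 := ne x hx.1 hxE (Ne.symm hxb)
      have n2 := ne y hy.1 hyE (Ne.symm hyb)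
      simp only [segreP_cons, List.toFinset_cons, Finset.union_insert, Finset.insert_union]
      rw [Finset.insert_comm y x D]
      generalize segreP T (insert x (insert y D)) A B = R
      have key : T (insert b (D ∪ B.toFinset)) x * (T (insert x (D ∪ B.toFinset)) y *
          (T (insert x (D ∪ B.toFinset)) b)⁻¹) = (-1) ^ (t + 1) *
          (T (insert b (D ∪ B.toFinset)) y * (T (insert y (D ∪ B.toFinset)) x *
          (T (insert y (D ∪ B.toFinset)) b)⁻¹)) := by
        field_simp
        linear_combination hseg
      linear_combination (T (insert b (D ∪ B.toFinset)) a)⁻¹ * R * key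
  | @trans A A' A'' h h' ih ih' =>
    obtain ⟨ε, h1, h2, h3⟩ := ih
    obtain ⟨ε', h1', h2', h3'⟩ := ih'
    refine ⟨ε' * ε, by linear_combination ε' * ε' * h1 + h1', fun P Q hl => ?_,
      fun D B hD hcard hl hnd hm => ?_⟩
    · rw [h2' P Q (by rw [← h.length_eq]; exact hl), h2 P Q hl]
      ring
    · rw [h3' D B hD (by rw [← h.length_eq]; exact hcard) (by rw [← h.length_eq]; exact hl)
        (((h.append_right B).nodup_iff).1 hnd)
        (fun v hv => hm v (((h.append_right B).mem_iff).2 hv)), h3 D B hD hcard hl hnd hm]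
      ring

theorem SegreConfig.segreTerm_perm [Fintype F] (hS : IsArc S) (hT : IsTangentFamily t S T)
    (ht : S.card + t = Fintype.card F + k - 1) {D L : List (Fin k → F)}
    {Ω : Finset (Fin k → F)} (hc : SegreConfig t S D L Ω) (hL : L ≠ [])
    {A A' : List (Fin k → F)} (hA : A.Nodup) (hAΩ : ∀ v ∈ A, v ∈ Ω)
    (hlen : A.length = L.length) (h : A.Perm A') :
    segreTerm T D L Ω A' = segreTerm T D L Ω A := by
  obtain ⟨ε, h1, h2, h3⟩ := exists_sign_of_perm hS hT ht h
  have hnd := List.nodup_append.1 hc.nodup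
  have hlk := hc.length
  have hε : ε⁻¹ = ε := inv_eq_of_mul_eq_one_left h1
  rw [segreTerm, segreTerm, h3]
  · have hdet (z : Fin k → F) : (detCols (z :: (A' ++ D)))⁻¹ =
        ε * (detCols (z :: (A ++ D)))⁻¹ := by
      have := h2 [z] D (by simp; omega)
      simp only [List.cons_append, List.nil_append] at this
      rw [this, mul_inv, hε]
    simp only [hdet]
    rw [← List.toFinset_eq_of_perm _ _ h, Finset.prod_mul_distrib, Finset.prod_const,
      hc.card_union_tail hL hA hAΩ hlen]
    have : ε ^ (t + 1) * ε ^ (t + 1) = 1 := by rw [← mul_pow, h1, one_pow]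
    linear_combination (segreP T D.toFinset A L *
      ∏ z ∈ (Ω \ A.toFinset) ∪ L.tail.toFinset, (detCols (z :: (A ++ D)))⁻¹) * this
  · exact fun v hv => hc.mem v (by simp at hv; simp [hv])
  · rw [List.toFinset_card_of_nodup hnd.2.1]; omega
  · exact hlen
  · rw [List.nodup_append]
    refine ⟨hA, hnd.1, fun a ha b hb hab => ?_⟩
    exact hc.notMem b (by simp [hb]) (hab ▸ hAΩ a ha)
  · intro v hv
    rw [List.mem_toFinset]
    rcases List.mem_append.1 hv with hv | hv
    · exact ⟨hc.subset (hAΩ v hv), fun h => hc.notMem v (by simp [h]) (hAΩ v hv)⟩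
    · exact ⟨hc.mem v (by simp [hv]), fun h => hnd.2.2 v hv v h rfl⟩

end SegreProduct

section SegreSum

theorem Finset.sum_powersetCard_erase_insert {α M : Type*} [DecidableEq α] [AddCommMonoid M]
    (s : Finset α) (n : ℕ) (g : Finset α → M) :
    ∑ x ∈ s, ∑ u ∈ Finset.powersetCard n (s.erase x), g (insert x u) =
      (n + 1) • ∑ u ∈ Finset.powersetCard (n + 1) s, g u := by
  have h : (n + 1) • ∑ u ∈ Finset.powersetCard (n + 1) s, g u =
      ∑ u ∈ Finset.powersetCard (n + 1) s, ∑ _x ∈ u, g u := by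
    rw [Finset.smul_sum]
    refine Finset.sum_congr rfl fun u hu => ?_
    rw [Finset.sum_const, (Finset.mem_powersetCard.1 hu).2]
  rw [h, Finset.sum_sigma', Finset.sum_sigma']
  refine Finset.sum_bij' (fun p _ => ⟨insert p.1 p.2, p.1⟩) (fun p _ => ⟨p.2, p.1.erase p.2⟩)
    ?_ ?_ ?_ ?_ ?_
  · rintro ⟨x, u⟩ hp
    simp only [Finset.mem_sigma, Finset.mem_powersetCard] at hp ⊢
    have hxu : x ∉ u := fun hx => Finset.notMem_erase x s (hp.2.1 hx)
    exact ⟨⟨Finset.insert_subset hp.1 (hp.2.1.trans (Finset.erase_subset _ _)),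
      by rw [Finset.card_insert_of_notMem hxu, hp.2.2]⟩, Finset.mem_insert_self _ _⟩
  · rintro ⟨u, x⟩ hp
    simp only [Finset.mem_sigma, Finset.mem_powersetCard] at hp ⊢
    exact ⟨hp.1.1 hp.2, Finset.erase_subset_erase _ hp.1.1,
      by rw [Finset.card_erase_of_mem hp.2, hp.1.2]; rfl⟩
  · rintro ⟨x, u⟩ hp
    simp only [Finset.mem_sigma, Finset.mem_powersetCard] at hp
    have hxu : x ∉ u := fun hx => Finset.notMem_erase x s (hp.2.1 hx)
    simp [Finset.erase_insert hxu]
  · rintro ⟨u, x⟩ hp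
    simp only [Finset.mem_sigma] at hp
    simp [Finset.insert_erase hp.2]
  · intros; rfl

variable {F : Type} [Field F] [DecidableEq F] {k t : ℕ} {S : Finset (Fin k → F)}
  {T : Finset (Fin k → F) → (Fin k → F) → F}

/-- The ratio `P_D(x A, ℓ₀ ℓ L) / P_{D ∪ x}(A, ℓ₀ L)` for a nonempty sequence `A`. -/
def segreRatio (T : Finset (Fin k → F) → (Fin k → F) → F) (Y : Finset (Fin k → F))
    (a b x : Fin k → F) : F :=
  T (insert b Y) x * T (insert x Y) a * (T (insert b Y) a * T (insert x Y) b)⁻¹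

/-- The tangent functions occurring in `segreRatio` do not vanish. -/
theorem SegreConfig.tangent_ne_zero (hT : IsTangentFamily t S T) {D L : List (Fin k → F)}
    {a b x : Fin k → F} {Ω : Finset (Fin k → F)} (hc : SegreConfig t S D (a :: b :: L) Ω)
    (hx : x ∈ Ω) :
    T (insert b (D.toFinset ∪ L.toFinset)) a ≠ 0 ∧ T (insert x (D.toFinset ∪ L.toFinset)) a ≠ 0 ∧
      T (insert x (D.toFinset ∪ L.toFinset)) b ≠ 0 := by
  obtain ⟨h1, h2, h3, h4, h5, h6⟩ := hc
  simp only [List.cons_append, List.nodup_cons, List.mem_append, List.mem_cons, not_or] at h3 h4 h5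
  have hne : ∀ v, v ∉ Ω → v ≠ x := fun v hv h => hv (h ▸ hx)
  have hEeq : D.toFinset ∪ L.toFinset = (L ++ D).toFinset := by
    ext v; simp [or_comm]
  have hE : (D.toFinset ∪ L.toFinset).card + 3 = k := by
    rw [hEeq, List.toFinset_card_of_nodup h3.2.2]
    simp at h1 ⊢; omega
  have hES : D.toFinset ∪ L.toFinset ⊆ S := by
    intro v hv
    simp only [Finset.mem_union, List.mem_toFinset] at hv
    exact h4 v (by tauto)
  have ne {u v : Fin k → F} (hu : u ∈ S) (hv : v ∈ S) (hu' : u ∉ D.toFinset ∪ L.toFinset)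
      (hv' : v ∉ D.toFinset ∪ L.toFinset) (huv : v ≠ u) :
      T (insert u (D.toFinset ∪ L.toFinset)) v ≠ 0 :=
    hT.ne_zero (Finset.insert_subset hu hES)
      (by rw [Finset.card_insert_of_notMem hu']; omega) hv
      (by rw [Finset.mem_insert, not_or]; exact ⟨huv, hv'⟩)
  have ha : a ∉ D.toFinset ∪ L.toFinset := by simp [h3.1.2.1, h3.1.2.2]
  have hb : b ∉ D.toFinset ∪ L.toFinset := by simp [h3.2.1.1, h3.2.1.2]
  have hx' : x ∉ D.toFinset ∪ L.toFinset := by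
    intro h
    simp only [Finset.mem_union, List.mem_toFinset] at h
    exact h5 x (by tauto) hx
  exact ⟨ne (h4 b (by simp)) (h4 a (by simp)) hb ha h3.1.1,
    ne (h6 hx) (h4 a (by simp)) hx' ha (hne a (h5 a (by simp))),
    ne (h6 hx) (h4 b (by simp)) hx' hb (hne b (h5 b (by simp)))⟩

theorem SegreConfig.ratio_mul_segreTerm (hT : IsTangentFamily t S T) {D L A : List (Fin k → F)}
    {a b x : Fin k → F} {Ω : Finset (Fin k → F)} (hc : SegreConfig t S D (a :: b :: L) Ω)
    (hx : x ∈ Ω) (hA : A.Nodup) (hAΩ : ∀ v ∈ A, v ∈ Ω.erase x) (hlen : A.length = L.length + 1) :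
    segreRatio T (D.toFinset ∪ L.toFinset) a b x *
        segreTerm T (x :: D) (a :: L) (insert b (Ω.erase x)) A =
      ((-1) ^ (L.length + 1)) ^ (t + 1) * segreTerm T D (a :: b :: L) Ω (x :: A) := by
  obtain ⟨n1, n2, n3⟩ := hc.tangent_ne_zero hT hx
  have hlk := hc.length
  have hxA : x ∉ A := fun h => Finset.notMem_erase x Ω (hAΩ x h)
  have hcard := hc.card_union_tail (by simp) (A := x :: A) (List.nodup_cons.2 ⟨hxA, hA⟩)
    (by
      intro v hv
      rcases List.mem_cons.1 hv with rfl | hv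
      exacts [hx, Finset.mem_of_mem_erase (hAΩ v hv)]) (by simp [hlen])
  have hset : (insert b (Ω.erase x) \ A.toFinset) ∪ (a :: L).tail.toFinset =
      (Ω \ (x :: A).toFinset) ∪ (a :: b :: L).tail.toFinset := by
    have hbA : b ∉ A := fun h => hc.notMem b (by simp) (Finset.mem_of_mem_erase (hAΩ b h))
    ext v
    simp only [List.tail_cons, List.toFinset_cons, Finset.mem_union, Finset.mem_sdiff,
      Finset.mem_insert, Finset.mem_erase, List.mem_toFinset, not_or]
    grind
  have hdet (z : Fin k → F) : (detCols (z :: (x :: A ++ D)))⁻¹ =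
      (-1) ^ (L.length + 1) * (detCols (z :: (A ++ x :: D)))⁻¹ := by
    have := detCols_move [z] A D x (by simp at hlk ⊢; omega)
    simp only [List.cons_append, List.nil_append] at this ⊢
    rw [this, mul_inv, hlen, ← inv_pow]
    norm_num
  rw [segreTerm, segreTerm, hset]
  simp only [hdet]
  rw [Finset.prod_mul_distrib, Finset.prod_const, hcard]
  have hsq : ((-1 : F) ^ (L.length + 1)) ^ (t + 1) * ((-1) ^ (L.length + 1)) ^ (t + 1) = 1 := by
    rw [← mul_pow, ← mul_pow]; simp
  obtain _ | ⟨y, A⟩ := A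
  · simp at hlen
  simp only [segreP_cons, segreRatio, List.toFinset_cons, Finset.union_insert, Finset.insert_union]
  have key : T (insert b (D.toFinset ∪ L.toFinset)) x * T (insert x (D.toFinset ∪ L.toFinset)) a *
      (T (insert b (D.toFinset ∪ L.toFinset)) a * T (insert x (D.toFinset ∪ L.toFinset)) b)⁻¹ *
      (T (insert x (D.toFinset ∪ L.toFinset)) a)⁻¹ = T (insert b (D.toFinset ∪ L.toFinset)) x *
      (T (insert b (D.toFinset ∪ L.toFinset)) a)⁻¹ *
      (T (insert x (D.toFinset ∪ L.toFinset)) b)⁻¹ := by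
    field_simp
  generalize (∏ z ∈ (Ω \ insert x (insert y A.toFinset)) ∪ (a :: b :: L).tail.toFinset,
    (detCols (z :: (y :: A ++ x :: D)))⁻¹) = Z
  generalize segreP T (insert y (insert x D.toFinset)) A L = R
  linear_combination T (insert x (D.toFinset ∪ L.toFinset)) y * R * Z * key -
    T (insert b (D.toFinset ∪ L.toFinset)) x *
      (T (insert b (D.toFinset ∪ L.toFinset)) a)⁻¹ *
      (T (insert x (D.toFinset ∪ L.toFinset)) b)⁻¹ * T (insert x (D.toFinset ∪ L.toFinset)) y *
      R * Z * hsq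

theorem SegreConfig.ratio_mul_segreTerm_cons (hT : IsTangentFamily t S T)
    {D L A : List (Fin k → F)} {a b x : Fin k → F} {Ω : Finset (Fin k → F)}
    (hc : SegreConfig t S D (a :: b :: L) Ω)
    (hx : x ∈ Ω) (hA : A.Nodup) (hAΩ : ∀ v ∈ A, v ∈ Ω.erase x) (hlen : A.length = L.length) :
    segreRatio T (D.toFinset ∪ L.toFinset) a b x *
        segreTerm T (x :: D) (a :: L) (insert b (Ω.erase x)) (b :: A) =
      (-1) ^ (t + 1) * segreTerm T (b :: D) (a :: L) Ω (x :: A) := by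
  obtain ⟨n1, n2, n3⟩ := hc.tangent_ne_zero hT hx
  have hlk := hc.length
  have hxA : x ∉ A := fun h => Finset.notMem_erase x Ω (hAΩ x h)
  have hcard := hc.move_left.card_union_tail (by simp) (A := x :: A)
    (List.nodup_cons.2 ⟨hxA, hA⟩)
    (by
      intro v hv
      rcases List.mem_cons.1 hv with rfl | hv
      exacts [hx, Finset.mem_of_mem_erase (hAΩ v hv)]) (by simp [hlen])
  have hset : (insert b (Ω.erase x) \ (b :: A).toFinset) ∪ (a :: L).tail.toFinset =
      (Ω \ (x :: A).toFinset) ∪ (a :: L).tail.toFinset := by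
    have hbΩ : b ∉ Ω := hc.notMem b (by simp)
    ext v
    simp only [List.tail_cons, List.toFinset_cons, Finset.mem_union, Finset.mem_sdiff,
      Finset.mem_insert, Finset.mem_erase, List.mem_toFinset, not_or]
    grind
  have hdet (z : Fin k → F) : (detCols (z :: (b :: A ++ x :: D)))⁻¹ =
      (-1) * (detCols (z :: (x :: A ++ b :: D)))⁻¹ := by
    have := detCols_exchange [z] A D b x (by simp at hlk ⊢; omega)
    simp only [List.cons_append, List.nil_append] at this ⊢
    rw [this, inv_neg]
    ring
  rw [segreTerm, segreTerm, hset]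
  simp only [hdet]
  rw [Finset.prod_mul_distrib, Finset.prod_const, hcard]
  simp only [segreP_cons, segreRatio, List.toFinset_cons, Finset.insert_union]
  rw [Finset.insert_comm b x]
  have key : T (insert b (D.toFinset ∪ L.toFinset)) x * T (insert x (D.toFinset ∪ L.toFinset)) a *
      (T (insert b (D.toFinset ∪ L.toFinset)) a * T (insert x (D.toFinset ∪ L.toFinset)) b)⁻¹ *
      (T (insert x (D.toFinset ∪ L.toFinset)) b * (T (insert x (D.toFinset ∪ L.toFinset)) a)⁻¹) =
      T (insert b (D.toFinset ∪ L.toFinset)) x *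
      (T (insert b (D.toFinset ∪ L.toFinset)) a)⁻¹ := by
    field_simp
  generalize (∏ z ∈ (Ω \ insert x A.toFinset) ∪ (a :: L).tail.toFinset,
    (detCols (z :: (x :: A ++ b :: D)))⁻¹) = Z
  generalize segreP T (insert x (insert b D.toFinset)) A L = R
  linear_combination (-1) ^ (t + 1) * R * Z * key

theorem SegreConfig.sum_segreTerm_eq_zero [Fintype F] (hS : IsArc S)
    (hT : IsTangentFamily t S T) (ht : S.card + t = Fintype.card F + k - 1) {p : ℕ} [CharP F p]
    {D L : List (Fin k → F)} {a : Fin k → F} {Ω : Finset (Fin k → F)}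
    (hc : SegreConfig t S D (a :: L) Ω) (hp : L.length + 2 ≤ p) :
    ∑ Δ ∈ Finset.powersetCard (L.length + 1) Ω, segreTerm T D (a :: L) Ω Δ.toList = 0 := by
  induction L generalizing D Ω with
  | nil =>
    have hlk := hc.length
    have hnd := hc.nodup
    simp only [List.cons_append, List.nil_append, List.nodup_cons] at hnd
    have hint := hT.interpolation hS (D := D) (by simp at hlk; omega) hnd.2
      (fun v hv => hc.mem v (by simp [hv])) hc.card hc.subset
      (fun v hv hD => hc.notMem v (by simp [hD]) hv)
    rw [List.length_nil, zero_add, Finset.powersetCard_one, Finset.sum_map]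
    have h (e : Fin k → F) : segreTerm T D [a] Ω [e] = (T D.toFinset a)⁻¹ *
        (T D.toFinset e * ∏ z ∈ Ω.erase e, (detCols (z :: e :: D))⁻¹) := by
      simp only [segreTerm, segreP_cons]
      simp [segreP, Finset.sdiff_singleton_eq_erase]
      ring
    simp only [Function.Embedding.coeFn_mk, Finset.toList_singleton, h]
    rw [← Finset.mul_sum, hint, mul_zero]
  | cons b L ih =>
    have hbΩ : b ∉ Ω := hc.notMem b (by simp)
    set f : Finset (Fin k → F) → F := fun Δ => segreTerm T D (a :: b :: L) Ω Δ.toList with hf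
    set g : Finset (Fin k → F) → F := fun Δ => segreTerm T (b :: D) (a :: L) Ω Δ.toList with hg
    have hfi : ∀ x ∈ Ω, ∀ u ∈ Finset.powersetCard (L.length + 1) (Ω.erase x),
        segreTerm T D (a :: b :: L) Ω (x :: u.toList) = f (insert x u) := by
      intro x hx u hu
      obtain ⟨hu, huc⟩ := Finset.mem_powersetCard.1 hu
      have hxu : x ∉ u := fun h => Finset.notMem_erase x Ω (hu h)
      have hperm := Finset.toList_insert hxu
      exact hc.segreTerm_perm hS hT ht (by simp) (Finset.nodup_toList _)
        (fun v hv => Finset.insert_subset hx (hu.trans (Finset.erase_subset _ _))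
          (Finset.mem_toList.1 hv)) (by simp [Finset.card_insert_of_notMem hxu, huc]) hperm
    have hgi : ∀ x ∈ Ω, ∀ u ∈ Finset.powersetCard L.length (Ω.erase x),
        segreTerm T (b :: D) (a :: L) Ω (x :: u.toList) = g (insert x u) := by
      intro x hx u hu
      obtain ⟨hu, huc⟩ := Finset.mem_powersetCard.1 hu
      have hxu : x ∉ u := fun h => Finset.notMem_erase x Ω (hu h)
      have hperm := Finset.toList_insert hxu
      exact hc.move_left.segreTerm_perm hS hT ht (by simp) (Finset.nodup_toList _)
        (fun v hv => Finset.insert_subset hx (hu.trans (Finset.erase_subset _ _))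
          (Finset.mem_toList.1 hv)) (by simp [Finset.card_insert_of_notMem hxu, huc]) hperm
    have hx_sum : ∀ x ∈ Ω,
        ((-1) ^ (L.length + 1)) ^ (t + 1) *
            ∑ u ∈ Finset.powersetCard (L.length + 1) (Ω.erase x), f (insert x u) +
          (-1) ^ (t + 1) * ∑ u ∈ Finset.powersetCard L.length (Ω.erase x), g (insert x u) = 0 := by
      intro x hx
      have hcx := hc.cons_left hx
      have hbx : b ∉ Ω.erase x := fun h => hbΩ (Finset.mem_of_mem_erase h)
      have h0 := ih hcx (by simp at hp; omega)
      rw [Finset.powersetCard_succ_insert hbx, Finset.sum_union, Finset.sum_image] at h0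
      · have h1 := congrArg (segreRatio T (D.toFinset ∪ L.toFinset) a b x * ·) h0
        simp only [mul_zero, mul_add] at h1
        rw [← h1, Finset.mul_sum, Finset.mul_sum, Finset.mul_sum, Finset.mul_sum]
        congr 1
        · refine Finset.sum_congr rfl fun u hu => ?_
          rw [← hfi x hx u hu]
          obtain ⟨hu, huc⟩ := Finset.mem_powersetCard.1 hu
          exact (hc.ratio_mul_segreTerm hT hx u.nodup_toList
            (fun v hv => hu (Finset.mem_toList.1 hv)) (by simp [huc])).symm
        · refine Finset.sum_congr rfl fun u hu => ?_
          rw [← hgi x hx u hu]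
          obtain ⟨hu, huc⟩ := Finset.mem_powersetCard.1 hu
          rw [← hc.ratio_mul_segreTerm_cons hT hx u.nodup_toList
            (fun v hv => hu (Finset.mem_toList.1 hv)) (by simp [huc])]
          have hbu : b ∉ u := fun h => hbx (hu h)
          rw [hcx.segreTerm_perm hS hT ht (by simp) (Finset.nodup_toList _) _ _
            (Finset.toList_insert hbu)]
          · intro v hv
            rw [Finset.mem_toList] at hv
            exact Finset.insert_subset_insert b hu hv
          · simp [Finset.card_insert_of_notMem hbu, huc]
      · intro u hu v hv huv
        have hbu : b ∉ u := fun h => hbx ((Finset.mem_powersetCard.1 hu).1 h)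
        have hbv : b ∉ v := fun h => hbx ((Finset.mem_powersetCard.1 hv).1 h)
        rw [← Finset.erase_insert hbu, ← Finset.erase_insert hbv]
        exact congrArg (Finset.erase · b) huv
      · rw [Finset.disjoint_right]
        intro u hu hu'
        obtain ⟨v, hv, rfl⟩ := Finset.mem_image.1 hu
        exact hbx ((Finset.mem_powersetCard.1 hu').1 (Finset.mem_insert_self _ _))
    have htot := Finset.sum_eq_zero hx_sum
    rw [Finset.sum_add_distrib, ← Finset.mul_sum, ← Finset.mul_sum,
      Finset.sum_powersetCard_erase_insert, Finset.sum_powersetCard_erase_insert] at htot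
    have hg0 : ∑ u ∈ Finset.powersetCard (L.length + 1) Ω, g u = 0 :=
      ih hc.move_left (by simp at hp; omega)
    rw [hg0, smul_zero, mul_zero, add_zero, nsmul_eq_mul] at htot
    have hcast : ((L.length + 1 + 1 : ℕ) : F) ≠ 0 := by
      rw [Ne, CharP.cast_eq_zero_iff F p]
      intro hdvd
      have := Nat.le_of_dvd (by omega) hdvd
      simp at hp
      omega
    have hsgn : ((-1 : F) ^ (L.length + 1)) ^ (t + 1) ≠ 0 :=
      pow_ne_zero _ (pow_ne_zero _ (neg_ne_zero.2 one_ne_zero))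
    exact (mul_eq_zero.1 ((mul_eq_zero.1 htot).resolve_left hsgn)).resolve_left hcast

end SegreSum

section Subseq

variable {α : Type}

theorem injOn_getD (d : α) {L : List α} (hL : L.Nodup) :
    Set.InjOn (fun i => L.getD i d) (Finset.range L.length) := by
  intro i hi j hj h
  have hi' := Finset.mem_range.1 (Finset.mem_coe.1 hi)
  have hj' := Finset.mem_range.1 (Finset.mem_coe.1 hj)
  simp only [List.getD_eq_getElem _ _ hi', List.getD_eq_getElem _ _ hj'] at h
  exact hL.getElem_inj_iff.1 h

theorem mem_subseq {d : α} {L : List α} {s : Finset ℕ} {v : α} :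
    v ∈ subseq d L s ↔ ∃ i < L.length, i ∈ s ∧ L.getD i d = v := by
  simp [subseq, and_assoc]

theorem mem_subseqC {d : α} {L : List α} {s : Finset ℕ} {v : α} :
    v ∈ subseqC d L s ↔ ∃ i < L.length, i ∉ s ∧ L.getD i d = v := by
  simp [subseqC, and_assoc]

theorem nodup_subseq (d : α) {L : List α} (hL : L.Nodup) (s : Finset ℕ) :
    (subseq d L s).Nodup := by
  refine List.Nodup.map_on (fun i hi j hj h => ?_) (List.nodup_range.filter _)
  exact injOn_getD d hL (by simpa using (List.mem_filter.1 hi).1)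
    (by simpa using (List.mem_filter.1 hj).1) h

theorem length_subseq (d : α) {L : List α} {s : Finset ℕ} (hs : s ⊆ Finset.range L.length) :
    (subseq d L s).length = s.card := by
  rw [subseq, List.length_map, ← List.toFinset_card_of_nodup (List.nodup_range.filter _)]
  congr 1
  ext i
  simpa using fun hi => Finset.mem_range.1 (hs hi)

theorem mem_of_mem_subseq {d : α} {L : List α} {s : Finset ℕ} {v : α}
    (hv : v ∈ subseq d L s) : v ∈ L := by
  obtain ⟨i, hi, -, rfl⟩ := mem_subseq.1 hv
  rw [List.getD_eq_getElem _ _ hi]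
  exact List.getElem_mem _

variable [DecidableEq α]

theorem toFinset_subseq (d : α) {L : List α} {s : Finset ℕ} (hs : s ⊆ Finset.range L.length) :
    (subseq d L s).toFinset = s.image (fun i => L.getD i d) := by
  ext v
  rw [List.mem_toFinset, mem_subseq, Finset.mem_image]
  exact ⟨fun ⟨i, _, hi, h⟩ => ⟨i, hi, h⟩, fun ⟨i, hi, h⟩ => ⟨i, Finset.mem_range.1 (hs hi), hi, h⟩⟩

theorem toFinset_subseqC (d : α) {L : List α} (hL : L.Nodup) (s : Finset ℕ) :
    (subseqC d L s).toFinset = L.toFinset \ (subseq d L s).toFinset := by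
  ext v
  rw [Finset.mem_sdiff, List.mem_toFinset, List.mem_toFinset, List.mem_toFinset, mem_subseqC,
    mem_subseq]
  constructor
  · rintro ⟨i, hi, his, rfl⟩
    refine ⟨by rw [List.getD_eq_getElem _ _ hi]; exact List.getElem_mem _, ?_⟩
    rintro ⟨j, hj, hjs, h⟩
    exact his (injOn_getD d hL (by simpa using hj) (by simpa using hi) h ▸ hjs)
  · rintro ⟨hv, h⟩
    obtain ⟨i, hi, rfl⟩ := List.getElem_of_mem hv
    exact ⟨i, hi, fun his => h ⟨i, hi, his, List.getD_eq_getElem _ _ hi⟩,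
      List.getD_eq_getElem _ _ hi⟩

theorem exists_toFinset_subseq_eq (d : α) {L : List α} {u : Finset α} (hu : u ⊆ L.toFinset) :
    ∃ s ⊆ Finset.range L.length, (subseq d L s).toFinset = u := by
  refine ⟨(Finset.range L.length).filter fun i => L.getD i d ∈ u, Finset.filter_subset _ _, ?_⟩
  ext v
  rw [List.mem_toFinset, mem_subseq]
  constructor
  · rintro ⟨i, -, hi, rfl⟩
    exact (Finset.mem_filter.1 hi).2
  · intro hv
    obtain ⟨i, hi, rfl⟩ := List.getElem_of_mem (List.mem_toFinset.1 (hu hv))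
    have h := List.getD_eq_getElem L d hi
    exact ⟨i, hi, Finset.mem_filter.2 ⟨Finset.mem_range.2 hi, h ▸ hv⟩, h⟩

end Subseq

/-- appendix lemma: for pairwise disjoint ordered subsequences `L` (size
`r`, first element `ℓ_0`), `D` (size `k − 1 − r`) and `Ω` (size `t + 2`) of `S`, if
`1 ≤ r ≤ t + 2` and `r ≤ p − 1`, then
`0 = ∑_{Δ ⊆ Ω, |Δ| = r} P_D(Δ, L) ∏_{z ∈ (Ω∖Δ)∪(L∖{ℓ_0})} det(z, Δ, D)⁻¹`,
each `Δ` carrying the order induced from `Ω`. -/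
theorem statement12 (p h k q t r : ℕ) (hp : p.Prime) (hh : 1 ≤ h) (hq : q = p ^ h)
    (hk : 3 ≤ k)
    (F : Type) [Field F] [Fintype F] [DecidableEq F] (hF : Fintype.card F = q)
    (S : Finset (Fin k → F))
    (harc : ∀ A ⊆ S, A.card = k →
      LinearIndependent F (fun v : {x // x ∈ A} => (v : Fin k → F)) ∧
      Submodule.span F (A : Set (Fin k → F)) = ⊤)
    (ht : S.card + t = q + k - 1) (ht1 : 1 ≤ t) (hSk : k ≤ S.card)
    (T : Finset (Fin k → F) → (Fin k → F) → F) (hT : IsTangentFamily t S T)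
    (L D Om : List (Fin k → F))
    (hL : L.length = r) (hD : D.length + r + 1 = k) (hOm : Om.length = t + 2)
    (hnd : (L ++ D ++ Om).Nodup) (hin : ∀ v ∈ L ++ D ++ Om, v ∈ S)
    (hr1 : 1 ≤ r) (hr2 : r ≤ t + 2) (hr3 : r + 1 ≤ p) :
    0 = ∑ sd ∈ Finset.powersetCard r (Finset.range Om.length),
        segreP T D.toFinset (subseq 0 Om sd) L *
          ∏ z ∈ (subseqC 0 Om sd).toFinset ∪ L.tail.toFinset,
            (detCols (z :: (subseq 0 Om sd ++ D)))⁻¹ := by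
  have hS : IsArc S := harc
  have hchar : CharP F p := by
    obtain ⟨p', hp', n, hp'', hcard⟩ := FiniteField.card' F
    rw [hF, hq] at hcard
    have h1 : p ∣ p' ^ (n : ℕ) := hcard ▸ dvd_pow_self p (by omega)
    rwa [(Nat.prime_dvd_prime_iff_eq hp hp'').1 (hp.dvd_of_dvd_pow h1)]
  obtain ⟨a, L, rfl⟩ := List.exists_cons_of_ne_nil (l := L) (by rintro rfl; simp at hL; omega)
  obtain ⟨hnd1, hOmn, hdis⟩ := List.nodup_append.1 hnd
  have hc : SegreConfig t S D (a :: L) Om.toFinset :=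
    { length := by omega
      card := by rw [List.toFinset_card_of_nodup hOmn, hOm]
      nodup := hnd1
      mem := fun v hv => hin v (List.mem_append_left _ hv)
      notMem := fun v hv h => hdis v hv v (List.mem_toFinset.1 h) rfl
      subset := fun v hv => hin v (List.mem_append_right _ (List.mem_toFinset.1 hv)) }
  have ht' : S.card + t = Fintype.card F + k - 1 := by rw [hF, ht]
  have hr : L.length + 1 = r := by simpa using hL
  rw [← hc.sum_segreTerm_eq_zero hS hT ht' (p := p) (by omega), hr]
  symm
  refine Finset.sum_bij (fun s _ => (subseq 0 Om s).toFinset) ?_ ?_ ?_ ?_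
  · intro s hs
    obtain ⟨hs, hsc⟩ := Finset.mem_powersetCard.1 hs
    rw [Finset.mem_powersetCard, List.toFinset_card_of_nodup (nodup_subseq 0 hOmn s),
      length_subseq 0 hs]
    exact ⟨fun v hv => List.mem_toFinset.2 (mem_of_mem_subseq (List.mem_toFinset.1 hv)), hsc⟩
  · intro s hs s' hs' h
    rw [toFinset_subseq 0 (Finset.mem_powersetCard.1 hs).1,
      toFinset_subseq 0 (Finset.mem_powersetCard.1 hs').1] at h
    exact Finset.coe_injective ((injOn_getD 0 hOmn).image_eq_image_iff
      (by exact_mod_cast (Finset.mem_powersetCard.1 hs).1)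
      (by exact_mod_cast (Finset.mem_powersetCard.1 hs').1) |>.1 (by exact_mod_cast h))
  · intro u hu
    obtain ⟨hu, huc⟩ := Finset.mem_powersetCard.1 hu
    obtain ⟨s, hs, rfl⟩ := exists_toFinset_subseq_eq 0 hu
    refine ⟨s, ?_, rfl⟩
    rw [List.toFinset_card_of_nodup (nodup_subseq 0 hOmn s), length_subseq 0 hs] at huc
    exact Finset.mem_powersetCard.2 ⟨hs, huc⟩
  · intro s hs
    obtain ⟨hs, hsc⟩ := Finset.mem_powersetCard.1 hs
    have hsn := nodup_subseq (0 : Fin k → F) hOmn s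
    rw [hc.segreTerm_perm hS hT ht' (by simp) hsn
      (fun v hv => List.mem_toFinset.2 (mem_of_mem_subseq hv))
      (by rw [length_subseq 0 hs, hsc, hL]) (List.toFinset_toList hsn).symm, segreTerm,
      toFinset_subseqC 0 hOmn]
end

section
/- Let p be a prime, h ≥ 2 an integer (so q = p^h is not prime), and let 2 ≤ k ≤ 2p − 2. If C is a k-dimensional linear subspace of 𝔽_q^n (a linear code of length n and dimension k) in which every nonzero codeword has Hamming weight at least n − k + 1 (i.e., C is a maximum distance separable code), then n ≤ q + 1. -/
theorem sum_powersetCard_insert_eq {ι F : Type*} [DecidableEq ι] [Field F] (E : Finset ι) (m : ℕ)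
    (φ f : Finset ι → F) :
    ∑ A ∈ E.powersetCard m, ∑ a ∈ E \ A, φ A * f (insert a A) =
      ∑ K ∈ E.powersetCard (m + 1), ∑ a ∈ K, φ (K.erase a) * f K := by
  rw [Finset.sum_sigma', Finset.sum_sigma']
  refine Finset.sum_bij' (fun x _ => ⟨insert x.2 x.1, x.2⟩) (fun x _ => ⟨x.1.erase x.2, x.2⟩)
    ?_ ?_ ?_ ?_ ?_
  · rintro ⟨A, a⟩ h
    simp only [Finset.mem_sigma, Finset.mem_powersetCard, Finset.mem_sdiff] at h ⊢
    refine ⟨⟨Finset.insert_subset h.2.1 h.1.1, ?_⟩, Finset.mem_insert_self _ _⟩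
    rw [Finset.card_insert_of_notMem h.2.2, h.1.2]
  · rintro ⟨K, a⟩ h
    simp only [Finset.mem_sigma, Finset.mem_powersetCard, Finset.mem_sdiff] at h ⊢
    refine ⟨⟨(Finset.erase_subset _ _).trans h.1.1, ?_⟩, h.1.1 h.2, Finset.notMem_erase _ _⟩
    rw [Finset.card_erase_of_mem h.2, h.1.2, Nat.add_sub_cancel]
  · rintro ⟨A, a⟩ h
    simp only [Finset.mem_sigma, Finset.mem_sdiff] at h
    simp [Finset.erase_insert h.2.2]
  · rintro ⟨K, a⟩ h
    simp only [Finset.mem_sigma] at h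
    simp [Finset.insert_erase h.2]
  · rintro ⟨A, a⟩ h
    simp only [Finset.mem_sigma, Finset.mem_sdiff] at h
    simp [Finset.erase_insert h.2.2]

/-- The inclusion matrix of `m`-subsets against `(m + 1)`-subsets of a `(2m + 1)`-set is
nonsingular when `(m + 1)!` is invertible. -/
theorem eq_zero_of_sum_insert_eq_zero {ι F : Type*} [DecidableEq ι] [Field F] (E : Finset ι)
    (m : ℕ) (hE : E.card = 2 * m + 1) (hm : ((m + 1).factorial : F) ≠ 0) (f : Finset ι → F)
    (hf : ∀ A ⊆ E, A.card = m → ∑ a ∈ E \ A, f (insert a A) = 0)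
    (D : Finset ι) (hD : D ⊆ E) (hDc : D.card = m + 1) : f D = 0 := by
  let c : ℕ → F := fun i => (-1) ^ i * i.factorial * (m - i).factorial
  have key := sum_powersetCard_insert_eq E m (fun A => c (A ∩ D).card) f
  have hL : ∑ A ∈ E.powersetCard m, ∑ a ∈ E \ A, c (A ∩ D).card * f (insert a A) = 0 := by
    refine Finset.sum_eq_zero fun A hA => ?_
    rw [Finset.mem_powersetCard] at hA
    rw [← Finset.mul_sum, hf A hA.1 hA.2, mul_zero]
  rw [hL, Finset.sum_eq_single D] at key
  · have h1 : ∀ a ∈ D, c (D.erase a ∩ D).card * f D = c m * f D := by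
      intro a ha
      rw [Finset.inter_eq_left.2 (Finset.erase_subset _ _), Finset.card_erase_of_mem ha, hDc,
        Nat.add_sub_cancel]
    rw [Finset.sum_congr rfl h1, Finset.sum_const, hDc, nsmul_eq_mul, ← mul_assoc, eq_comm,
      mul_eq_zero] at key
    refine key.resolve_left ?_
    rw [Nat.factorial_succ, Nat.cast_mul, mul_ne_zero_iff] at hm
    simp only [c, Nat.sub_self, Nat.factorial_zero, Nat.cast_one, mul_one]
    exact mul_ne_zero hm.1 (mul_ne_zero (pow_ne_zero _ (by simp)) hm.2)
  · intro K hK hKD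
    rw [Finset.mem_powersetCard] at hK
    rw [← Finset.sum_mul]
    refine mul_eq_zero_of_left ?_ _
    have hlt : (K ∩ D).card < m + 1 := by
      by_contra! h
      have h1 := Finset.eq_of_subset_of_card_le (Finset.inter_subset_left (s₁ := K) (s₂ := D))
        (by omega)
      have h2 := Finset.eq_of_subset_of_card_le (Finset.inter_subset_right (s₁ := K) (s₂ := D))
        (by omega)
      exact hKD (h1.symm.trans h2)
    have hpos : 0 < (K ∩ D).card := by
      have h1 := Finset.card_union_add_card_inter K D
      have h2 := Finset.card_le_card (Finset.union_subset hK.1 hD)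
      omega
    obtain ⟨i, hi⟩ : ∃ i, (K ∩ D).card = i + 1 := ⟨_, (Nat.succ_pred_eq_of_pos hpos).symm⟩
    rw [← Finset.sum_inter_add_sum_sdiff K D]
    have h1 : ∀ a ∈ K ∩ D, c (K.erase a ∩ D).card = c i := by
      intro a ha
      rw [Finset.erase_inter, Finset.card_erase_of_mem ha, hi, Nat.add_sub_cancel]
    have h2 : ∀ a ∈ K \ D, c (K.erase a ∩ D).card = c (i + 1) := by
      intro a ha
      rw [Finset.erase_inter, Finset.erase_eq_of_notMem, hi]
      simp only [Finset.mem_sdiff] at ha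
      simp [ha.2]
    have h3 : (K \ D).card = m - i := by
      have := Finset.card_sdiff_add_card_inter K D
      omega
    rw [Finset.sum_congr rfl h1, Finset.sum_congr rfl h2, Finset.sum_const, Finset.sum_const, hi,
      h3, nsmul_eq_mul, nsmul_eq_mul]
    obtain ⟨j, rfl⟩ : ∃ j, m = i + 1 + j := ⟨m - (i + 1), by omega⟩
    have e1 : i + 1 + j - i = j + 1 := by omega
    have e2 : i + 1 + j - (i + 1) = j := by omega
    simp only [c, e1, e2, Nat.factorial_succ]
    push_cast
    ring
  · intro h
    exact absurd (Finset.mem_powersetCard.2 ⟨hD, hDc⟩) h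

/-- `IsIteratedDifference w s T g` says that `g` arises from `w` by applying, for `s` pairwise
disjoint pairs `(a, b)` with union `T`, the operator sending `f` to
`X ↦ f (X ∪ {a}) - f (X ∪ {b})`. -/
inductive IsIteratedDifference {ι M : Type*} [DecidableEq ι] [AddCommGroup M]
    (w : Finset ι → M) : ℕ → Finset ι → (Finset ι → M) → Prop
  | zero : IsIteratedDifference w 0 ∅ w
  | succ {s : ℕ} {T : Finset ι} {g : Finset ι → M} {a b : ι} (h : IsIteratedDifference w s T g)
      (ha : a ∉ T) (hb : b ∉ T) (hab : a ≠ b) :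
      IsIteratedDifference w (s + 1) (insert a (insert b T))
        (fun X => g (insert a X) - g (insert b X))

namespace IsIteratedDifference

variable {ι F : Type*} [DecidableEq ι] [Field F] {w : Finset ι → ι → F} {s : ℕ} {T : Finset ι}
  {g : Finset ι → ι → F}

theorem card_eq (h : IsIteratedDifference w s T g) : T.card = 2 * s := by
  induction h with
  | zero => simp
  | succ h ha hb hab ih =>
    rw [Finset.card_insert_of_notMem (by simp [ha, hab]), Finset.card_insert_of_notMem hb, ih]
    ring

theorem mem (h : IsIteratedDifference w s T g) {V : Submodule F (ι → F)} (hw : ∀ K, w K ∈ V)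
    (X : Finset ι) : g X ∈ V := by
  induction h generalizing X with
  | zero => exact hw X
  | succ h ha hb hab ih => exact V.sub_mem (ih _) (ih _)

theorem apply_eq_zero (h : IsIteratedDifference w s T g) (hw : ∀ K, ∀ i ∈ K, w K i = 0)
    (X : Finset ι) (i : ι) (hi : i ∈ X) : g X i = 0 := by
  induction h generalizing X with
  | zero => exact hw X i hi
  | succ h ha hb hab ih =>
    change (_ - _ : F) = 0
    rw [ih _ (Finset.mem_insert_of_mem hi), ih _ (Finset.mem_insert_of_mem hi),
      sub_zero]

theorem sum_insert_eq_zero (h : IsIteratedDifference w s T g) {G : Finset ι} {m : ℕ} {u : ι}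
    (hw : ∀ A ⊆ G.erase u, A.card + 1 = m → ∑ x ∈ G.erase u \ A, w (insert x A) u = 0)
    (hT : T ⊆ G.erase u) (A : Finset ι) (hA : A ⊆ G.erase u \ T) (hAc : A.card + s + 1 = m) :
    ∑ x ∈ (G.erase u \ T) \ A, g (insert x A) u = 0 := by
  induction h generalizing A with
  | zero => simpa using hw A (by simpa using hA) hAc
  | @succ s T g a b h ha hb hab ih =>
    set E := G.erase u
    have haE : a ∈ E := hT (by simp)
    have hbE : b ∈ E := hT (by simp)
    have hTE : T ⊆ E := fun x hx => hT (by simp [hx])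
    have haA : a ∉ A := fun h => by simpa using hA h
    have hbA : b ∉ A := fun h => by simpa using hA h
    have hAT : A ⊆ E \ T := fun x hx => by
      have := hA hx
      simp only [Finset.mem_sdiff, Finset.mem_insert, not_or] at this ⊢
      tauto
    have h1 := ih hTE (insert a A) (Finset.insert_subset (by simp [haE, ha]) hAT)
      (by rw [Finset.card_insert_of_notMem haA]; omega)
    have h2 := ih hTE (insert b A) (Finset.insert_subset (by simp [hbE, hb]) hAT)
      (by rw [Finset.card_insert_of_notMem hbA]; omega)
    have e1 : (E \ T) \ insert a A = insert b ((E \ insert a (insert b T)) \ A) := by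
      ext x
      simp only [Finset.mem_sdiff, Finset.mem_insert]
      grind
    have e2 : (E \ T) \ insert b A = insert a ((E \ insert a (insert b T)) \ A) := by
      ext x
      simp only [Finset.mem_sdiff, Finset.mem_insert]
      grind
    rw [e1, Finset.sum_insert (by simp)] at h1
    rw [e2, Finset.sum_insert (by simp)] at h2
    simp only [Pi.sub_apply, Finset.sum_sub_distrib]
    rw [Finset.insert_comm] at h2
    simp only [Finset.insert_comm a _ A, Finset.insert_comm b _ A]
    rw [eq_neg_of_add_eq_zero_right h1, eq_neg_of_add_eq_zero_right h2, sub_self]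

end IsIteratedDifference

theorem eq_zero_of_sum_insert_apply_eq_zero {ι F : Type*} [DecidableEq ι] [Field F] {p m : ℕ}
    (hp : p.Prime) [CharP F p] (hm : 1 ≤ m) (hmp : m + 3 ≤ 2 * p) (V : Submodule F (ι → F))
    (G : Finset ι) (hG : G.card = 2 * m)
    (hV : ∀ c ∈ V, ∀ Z ⊆ G, m + 1 ≤ Z.card → (∀ i ∈ Z, c i = 0) → c = 0)
    (w : Finset ι → ι → F) (hwV : ∀ K, w K ∈ V) (hw0 : ∀ K, ∀ i ∈ K, w K i = 0)
    (hw : ∀ u ∈ G, ∀ A ⊆ G.erase u, A.card + 1 = m →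
      ∑ x ∈ G.erase u \ A, w (insert x A) u = 0)
    (K : Finset ι) (u : ι) (hu : u ∈ G) (hK : K ⊆ G.erase u) (hKc : K.card = m) :
    w K u = 0 := by
  have main : ∀ d s : ℕ, s + d = m + 1 - p → ∀ T g, IsIteratedDifference w s T g →
      ∀ u ∈ G, ∀ X, T ⊆ G.erase u → X ⊆ G.erase u \ T → X.card + s = m → g X u = 0 := by
    intro d
    induction d with
    | zero =>
      intro s hs T g hg u hu X hT hX hXc
      have hp2 := hp.two_le
      obtain ⟨l, hl⟩ : ∃ l, m = s + l + 1 := ⟨m - s - 1, by omega⟩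
      refine eq_zero_of_sum_insert_eq_zero (G.erase u \ T) l ?_ ?_ (fun X => g X u) ?_ X hX
        (by omega)
      · rw [Finset.card_sdiff_of_subset hT, Finset.card_erase_of_mem hu, hG, hg.card_eq]
        omega
      · rw [Ne, CharP.cast_eq_zero_iff F p, hp.dvd_factorial]
        omega
      · intro A hA hAc
        exact hg.sum_insert_eq_zero (hw u hu) hT A hA (by omega)
    | succ d ih =>
      intro s hs T g hg u hu X hT hX hXc
      obtain ⟨b, hb⟩ : X.Nonempty := Finset.card_pos.1 (by omega)
      have hbT := hX hb
      simp only [Finset.mem_sdiff, Finset.mem_erase] at hbT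
      have huT : u ∉ T := fun h => by simpa using hT h
      have hd := hg.succ huT hbT.2 (Ne.symm hbT.1.1)
      have hz : g (insert u (X.erase b)) - g (insert b (X.erase b)) = 0 := by
        refine hV _ (hd.mem hwV _) (G \ insert u (insert b T)) Finset.sdiff_subset ?_ ?_
        · rw [Finset.card_sdiff_of_subset, hd.card_eq, hG]
          · omega
          · refine Finset.insert_subset hu (Finset.insert_subset hbT.1.2 ?_)
            exact hT.trans (Finset.erase_subset _ _)
        · intro v hv
          simp only [Finset.mem_sdiff, Finset.mem_insert, not_or] at hv
          by_cases hvX : v ∈ X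
          · exact hd.apply_eq_zero hw0 _ _ (Finset.mem_erase.2 ⟨hv.2.2.1, hvX⟩)
          · refine ih (s + 1) (by omega) _ _ hd v hv.1 (X.erase b) ?_ ?_ ?_
            · intro x hx
              have := @hT x
              simp only [Finset.mem_insert, Finset.mem_erase] at hx this ⊢
              grind
            · intro x hx
              have := @hX x
              simp only [Finset.mem_insert, Finset.mem_erase, Finset.mem_sdiff] at hx this ⊢
              grind
            · rw [Finset.card_erase_of_mem hb]
              have := Finset.card_pos.2 ⟨b, hb⟩
              omega
      have := congrFun hz u
      rw [Finset.insert_erase hb, Pi.sub_apply,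
        hg.apply_eq_zero hw0 _ u (Finset.mem_insert_self _ _), zero_sub] at this
      simpa using this
  exact main (m + 1 - p) 0 (by omega) ∅ w .zero u hu K (by simp) (by simpa using hK) (by omega)

theorem prod_erase_sub_eq_neg_one {F : Type*} [Field F] [Fintype F] [DecidableEq F] (c : F) :
    ∏ y ∈ Finset.univ.erase c, (c - y) = -1 := by
  have h : ∏ u : Fˣ, (u : F) = -1 := by
    have := congrArg (fun u : Fˣ => (u : F)) (FiniteField.prod_univ_units_id_eq_neg_one (K := F))
    simpa using this
  rw [← h]
  symm
  refine Finset.prod_bij (fun (u : Fˣ) _ => c - (u : F)) ?_ ?_ ?_ ?_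
  · intro u _
    simp
  · intro u _ v _ huv
    simpa [Units.ext_iff] using huv
  · intro y hy
    have hy' : c - y ≠ 0 := sub_ne_zero.2 (Ne.symm (Finset.ne_of_mem_erase hy))
    exact ⟨Units.mk0 _ hy', Finset.mem_univ _, by simp⟩
  · intro u _
    simp

theorem prod_erase_sub_mul_eval_nodal {ι F : Type*} [DecidableEq ι] [Field F] [Fintype F]
    [DecidableEq F] (N : Finset ι) (x : ι → F) (hx : Set.InjOn x N) (a : ι) (ha : a ∈ N) :
    (∏ s ∈ N.erase a, (x a - x s)) *
      (Lagrange.nodal (Finset.univ \ N.image x) id).eval (x a) = -1 := by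
  rw [Lagrange.eval_nodal, ← prod_erase_sub_eq_neg_one (x a)]
  have h1 : ∏ s ∈ N.erase a, (x a - x s) = ∏ y ∈ (N.erase a).image x, (x a - y) := by
    rw [Finset.prod_image]
    exact fun s hs t ht => hx (Finset.mem_of_mem_erase hs) (Finset.mem_of_mem_erase ht)
  simp only [id]
  rw [h1, ← Finset.prod_union]
  · refine Finset.prod_congr ?_ fun _ _ => rfl
    ext y
    simp only [Finset.mem_union, Finset.mem_image, Finset.mem_erase, Finset.mem_sdiff,
      Finset.mem_univ, true_and, and_true]
    constructor
    · rintro (⟨s, ⟨hsa, hs⟩, rfl⟩ | h)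
      · exact fun h => hsa (hx hs ha h)
      · rintro rfl
        exact h ⟨a, ha, rfl⟩
    · intro hy
      by_cases h : ∃ s ∈ N, x s = y
      · obtain ⟨s, hs, rfl⟩ := h
        exact Or.inl ⟨s, ⟨fun h => hy (h ▸ rfl), hs⟩, rfl⟩
      · exact Or.inr h
  · rw [Finset.disjoint_left]
    intro y hy hy'
    obtain ⟨s, hs, rfl⟩ := Finset.mem_image.1 hy
    exact (Finset.mem_sdiff.1 hy').2 (Finset.mem_image_of_mem _ (Finset.mem_of_mem_erase hs))

theorem sum_prod_inv_eq_zero {ι F : Type*} [DecidableEq ι] [Field F] [Fintype F]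
    [DecidableEq F] (N E : Finset ι) (x l : ι → F) (hEN : E ⊆ N)
    (hx : Set.InjOn x N) (hl : ∀ i ∈ N, l i ≠ 0)
    (hcard : N.card + E.card = Fintype.card F + 2) :
    ∑ a ∈ E, (l a)⁻¹ * (∏ s ∈ N.erase a, l s * l a * (x a - x s))⁻¹ *
      (∏ z ∈ E.erase a, l z * l a * (x a - x z))⁻¹ = 0 := by
  have hNc : (N.image x).card = N.card := Finset.card_image_of_injOn hx
  have hNle : N.card ≤ Fintype.card F := hNc ▸ Finset.card_le_univ _
  set g := Lagrange.nodal (Finset.univ \ N.image x) (id : F → F) with hg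
  have hgdeg : g.natDegree = Fintype.card F - N.card := by
    rw [hg, Lagrange.natDegree_nodal, Finset.card_sdiff_of_subset (Finset.subset_univ _),
      Finset.card_univ, hNc]
  have hsum := Lagrange.coeff_eq_sum (s := E) (v := x) (hx.mono hEN) (P := g) (by
    refine lt_of_le_of_lt Polynomial.degree_le_natDegree ?_
    rw [hgdeg]
    exact_mod_cast (by omega : Fintype.card F - N.card < E.card))
  rw [Polynomial.coeff_eq_zero_of_natDegree_lt (by omega)] at hsum
  rw [← mul_zero (-((∏ s ∈ N, l s)⁻¹ * (∏ s ∈ E, l s)⁻¹)), hsum, Finset.mul_sum]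
  refine Finset.sum_congr rfl fun a ha => ?_
  have haN := hEN ha
  have hla := hl a haN
  have hN := prod_erase_sub_mul_eval_nodal N x hx a haN
  rw [← hg] at hN
  have hpow : l a * l a ^ (N.erase a).card * l a ^ (E.erase a).card = l a * l a := by
    have h1 := Finset.card_pos.2 ⟨a, haN⟩
    have h2 := Finset.card_pos.2 ⟨a, ha⟩
    have h3 : N.card - 1 + 1 + (E.card - 1) = Fintype.card F + 1 := by omega
    rw [Finset.card_erase_of_mem haN, Finset.card_erase_of_mem ha, ← pow_succ', ← pow_add, h3,
      pow_succ, FiniteField.pow_card]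
  have hPN : ∏ s ∈ N.erase a, (x a - x s) ≠ 0 := by
    intro h
    rw [h, zero_mul] at hN
    simp at hN
  have hPE : ∏ s ∈ E.erase a, (x a - x s) ≠ 0 := by
    rw [Finset.prod_ne_zero_iff] at hPN ⊢
    exact fun s hs => hPN s (Finset.erase_subset_erase _ hEN hs)
  have hlN : ∏ s ∈ N.erase a, l s ≠ 0 :=
    Finset.prod_ne_zero_iff.2 fun s hs => hl s (Finset.mem_of_mem_erase hs)
  have hlE : ∏ s ∈ E.erase a, l s ≠ 0 :=
    Finset.prod_ne_zero_iff.2 fun s hs => hl s (hEN (Finset.mem_of_mem_erase hs))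
  rw [eq_div_of_mul_eq hPN ((mul_comm _ _).trans hN), ← Finset.mul_prod_erase N l haN,
    ← Finset.mul_prod_erase E l ha]
  simp only [Finset.prod_mul_distrib, Finset.prod_const]
  have hpN := pow_ne_zero (N.erase a).card hla
  have hpE := pow_ne_zero (E.erase a).card hla
  have : (l a)⁻¹ * (l a ^ (N.erase a).card)⁻¹ * (l a ^ (E.erase a).card)⁻¹ =
      (l a)⁻¹ * (l a)⁻¹ := by
    rw [← mul_inv, ← mul_inv, hpow, mul_inv]
  simp only [mul_inv, div_eq_mul_inv]
  linear_combination (∏ s ∈ N.erase a, l s)⁻¹ * (∏ s ∈ E.erase a, l s)⁻¹ *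
    (∏ s ∈ N.erase a, (x a - x s))⁻¹ * (∏ s ∈ E.erase a, (x a - x s))⁻¹ * this

/-- The linear functional `s ↦ det (s, A)`. -/
def detForm {F : Type*} [Field F] {n : ℕ} (A : Fin n → Fin (n + 1) → F) :
    (Fin (n + 1) → F) →ₗ[F] F where
  toFun s := (Matrix.detRowAlternating (R := F) (n := Fin (n + 1))).curryLeft s A
  map_add' s t := by simp
  map_smul' c s := by simp

theorem detForm_apply {F : Type*} [Field F] {n : ℕ} (A : Fin n → Fin (n + 1) → F)
    (s : Fin (n + 1) → F) :
    detForm A s = Matrix.detRowAlternating (Matrix.vecCons s A) := rfl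

theorem detForm_comp_perm {F : Type*} [Field F] {n : ℕ} (A : Fin n → Fin (n + 1) → F)
    (σ : Equiv.Perm (Fin n)) (s : Fin (n + 1) → F) :
    detForm (A ∘ σ) s = ((Equiv.Perm.sign σ : ℤ) : F) * detForm A s := by
  have := ((Matrix.detRowAlternating (R := F) (n := Fin (n + 1))).curryLeft s).map_perm A σ
  rw [Units.smul_def, zsmul_eq_mul] at this
  exact this

theorem detForm_apply_eq_zero {F : Type*} [Field F] {n : ℕ} (A : Fin n → Fin (n + 1) → F)
    (i : Fin n) : detForm A (A i) = 0 := by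
  rw [detForm_apply]
  exact AlternatingMap.map_eq_zero_of_eq _ _ (i := 0) (j := i.succ) (by simp)
    (Fin.succ_ne_zero i).symm

theorem detForm_vecCons_swap {F : Type*} [Field F] {n : ℕ} (A : Fin n → Fin (n + 2) → F)
    (s t : Fin (n + 2) → F) :
    detForm (Matrix.vecCons s A) t = -detForm (Matrix.vecCons t A) s := by
  rw [detForm_apply, detForm_apply, ← AlternatingMap.map_swap _ _ (i := 0) (j := 1) (by simp)]
  congr 1
  ext i : 1
  refine Fin.cases ?_ (fun i => ?_) i
  · simp
  · refine Fin.cases ?_ (fun i => ?_) i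
    · simp
    · rw [Function.comp_apply, Equiv.swap_apply_of_ne_of_ne (Fin.succ_ne_zero _)]
      · simp
      · rw [← Fin.succ_zero_eq_one, Ne, Fin.succ_inj]
        exact Fin.succ_ne_zero i

theorem detForm_plucker {F : Type*} [Field F] {n : ℕ} (A : Fin n → Fin (n + 2) → F)
    (u j a s : Fin (n + 2) → F) (h : detForm (Matrix.vecCons j A) u ≠ 0) :
    detForm (Matrix.vecCons j A) u * detForm (Matrix.vecCons a A) s =
      detForm (Matrix.vecCons s A) u * detForm (Matrix.vecCons a A) j -
      detForm (Matrix.vecCons a A) u * detForm (Matrix.vecCons s A) j := by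
  have hli : LinearIndependent F (Matrix.vecCons u (Matrix.vecCons j A)) := by
    have : IsUnit (Matrix.of (Matrix.vecCons u (Matrix.vecCons j A))) := by
      rw [Matrix.isUnit_iff_isUnit_det]
      exact isUnit_iff_ne_zero.2 h
    exact Matrix.linearIndependent_rows_iff_isUnit.2 this
  have hspan := hli.span_eq_top_of_card_eq_finrank' (by simp)
  have key : detForm (Matrix.vecCons j A) u • detForm (Matrix.vecCons a A) =
      detForm (Matrix.vecCons a A) u • detForm (Matrix.vecCons j A) -
      detForm (Matrix.vecCons a A) j • detForm (Matrix.vecCons u A) := by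
    refine LinearMap.ext_on_range hspan fun i => ?_
    simp only [LinearMap.smul_apply, LinearMap.sub_apply, smul_eq_mul]
    refine Fin.cases ?_ (fun i => ?_) i
    · have := detForm_apply_eq_zero (Matrix.vecCons u A) 0
      simp only [Matrix.cons_val_zero] at this ⊢
      rw [this]
      ring
    · refine Fin.cases ?_ (fun i => ?_) i
      · have := detForm_apply_eq_zero (Matrix.vecCons j A) 0
        simp only [Matrix.cons_val_zero, Matrix.cons_val_succ] at this ⊢
        rw [this, detForm_vecCons_swap A u j]
        ring
      · have this := fun t => detForm_apply_eq_zero (Matrix.vecCons t A) i.succ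
        simp only [Matrix.cons_val_succ] at this ⊢
        simp [this]
  have := congrArg (fun f => f s) key
  simp only [LinearMap.smul_apply, LinearMap.sub_apply, smul_eq_mul] at this
  rw [this, detForm_vecCons_swap A u s, detForm_vecCons_swap A j s]
  ring

theorem comp_vecCons {α β : Type*} {n : ℕ} (g : α → β) (a : α) (c : Fin n → α) :
    g ∘ Matrix.vecCons a c = Matrix.vecCons (g a) (g ∘ c) :=
  Fin.comp_cons g a c

/-- The functional `det (·, c)`, rescaled so that it does not depend on the order of `c`. -/
noncomputable def scaledDetForm {ι F : Type*} [DecidableEq ι] [Field F] {n : ℕ}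
    (v : ι → Fin (n + 1) → F) (S G : Finset ι) (c : Fin n → ι) : (Fin (n + 1) → F) →ₗ[F] F :=
  ((∏ s ∈ S \ Finset.univ.image c, detForm (v ∘ c) (v s))⁻¹ *
    (∏ z ∈ G \ Finset.univ.image c, detForm (v ∘ c) (v z))⁻¹) • detForm (v ∘ c)

theorem scaledDetForm_comp_perm {ι F : Type*} [DecidableEq ι] [Field F] [Fintype F] {n : ℕ}
    (v : ι → Fin (n + 1) → F) (S G : Finset ι) (hS : S.card = Fintype.card F + 2)
    (hGS : G ⊆ S) (hG : G.card = 2 * n) (c : Fin n → ι) (hc : Function.Injective c)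
    (hcG : ∀ i, c i ∈ G) (σ : Equiv.Perm (Fin n)) :
    scaledDetForm v S G (c ∘ σ) = scaledDetForm v S G c := by
  have himg : Finset.univ.image (c ∘ σ) = Finset.univ.image c := by
    rw [← Finset.image_image, Finset.image_univ_equiv]
  have hcard : (Finset.univ.image c).card = n := by
    rw [Finset.card_image_of_injective _ hc, Finset.card_univ, Fintype.card_fin]
  have hsub : Finset.univ.image c ⊆ G := by
    intro x hx
    obtain ⟨i, -, rfl⟩ := Finset.mem_image.1 hx
    exact hcG i
  have hn : n ≤ Fintype.card F + 2 := by
    have := Finset.card_le_card hGS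
    omega
  set e : F := ((Equiv.Perm.sign σ : ℤ) : F) with he
  have hee : e * e = 1 := by
    rw [he, ← Int.cast_mul, Int.units_coe_mul_self, Int.cast_one]
  have hpow : e ^ (Fintype.card F + 2) = e := by
    rw [pow_add, FiniteField.pow_card, sq, hee, mul_one]
  ext1 i
  ext1
  simp only [scaledDetForm, himg, ← Function.comp_assoc, LinearMap.coe_comp, Function.comp_apply,
    LinearMap.smul_apply, smul_eq_mul, detForm_comp_perm, Finset.prod_mul_distrib,
    Finset.prod_const, Finset.card_sdiff_of_subset hsub,
    Finset.card_sdiff_of_subset (hsub.trans hGS), hcard, hS, hG, ← he, mul_inv]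
  have h1 : 2 * n - n = n := by omega
  have h2 : (e ^ (Fintype.card F + 2 - n))⁻¹ * (e ^ n)⁻¹ * e = 1 := by
    rw [← mul_inv, ← pow_add, Nat.sub_add_cancel hn, hpow]
    exact inv_mul_cancel₀ (left_ne_zero_of_mul_eq_one hee)
  rw [h1]
  linear_combination (∏ s ∈ S \ Finset.univ.image c, detForm (v ∘ c) (v s))⁻¹ *
    (∏ z ∈ G \ Finset.univ.image c, detForm (v ∘ c) (v z))⁻¹ *
    detForm (v ∘ c) (LinearMap.single F (fun _ => F) i 1) * h2

theorem sum_scaledDetForm_eq_zero {ι F : Type*} [DecidableEq ι] [Field F] [Fintype F]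
    [DecidableEq F] {n : ℕ} (v : ι → Fin (n + 2) → F)
    (hv : ∀ c : Fin (n + 2) → ι, Function.Injective c →
      Matrix.detRowAlternating (R := F) (v ∘ c) ≠ 0)
    (S G : Finset ι) (hS : S.card = Fintype.card F + 2) (hGS : G ⊆ S)
    (hG : G.card = 2 * (n + 1)) (c : Fin n → ι) (hc : Function.Injective c)
    (u : ι) (hu : u ∈ G) (hcu : Finset.univ.image c ⊆ G.erase u) :
    ∑ a ∈ G.erase u \ Finset.univ.image c,
      scaledDetForm v S G (Matrix.vecCons a c) (v u) = 0 := by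
  set A := Finset.univ.image c with hA
  have hAc : A.card = n := by
    rw [Finset.card_image_of_injective _ hc, Finset.card_univ, Fintype.card_fin]
  have huS := hGS hu
  have hcS : A ⊆ S.erase u := hcu.trans (Finset.erase_subset_erase _ hGS)
  set B : ι → ι → F := fun s a => detForm (Matrix.vecCons (v a) (v ∘ c)) (v s)
  have hB : ∀ s a, s ≠ a → s ∉ A → a ∉ A → B s a ≠ 0 := by
    intro s a hsa hs ha
    have := hv (Matrix.vecCons s (Matrix.vecCons a c)) (by
      rw [Matrix.vecCons, Matrix.vecCons, Fin.cons_injective_iff, Fin.cons_injective_iff]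
      refine ⟨?_, ?_, hc⟩
      · rintro ⟨i, hi⟩
        revert hi
        refine Fin.cases ?_ (fun i => ?_) i
        · exact fun h => hsa h.symm
        · exact fun h => hs (Finset.mem_image.2 ⟨i, Finset.mem_univ _, h⟩)
      · rintro ⟨i, hi⟩
        exact ha (Finset.mem_image.2 ⟨i, Finset.mem_univ _, hi⟩))
    rwa [comp_vecCons, comp_vecCons] at this
  have huA : u ∉ A := fun h => by simpa using hcu h
  set N := S.erase u \ A with hN
  set E := G.erase u \ A with hE
  have hEN : E ⊆ N := Finset.sdiff_subset_sdiff (Finset.erase_subset_erase _ hGS) subset_rfl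
  have hNc : N.card = Fintype.card F + 1 - n := by
    rw [hN, Finset.card_sdiff_of_subset hcS, Finset.card_erase_of_mem huS, hS, hAc]
    rfl
  have hEc : E.card = n + 1 := by
    rw [hE, Finset.card_sdiff_of_subset hcu, Finset.card_erase_of_mem hu, hG, hAc]
    omega
  obtain ⟨j, hj⟩ : E.Nonempty := Finset.card_pos.1 (by omega)
  have hmemN : ∀ i ∈ N, i ≠ u ∧ i ∉ A := fun i hi => by
    simp only [hN, Finset.mem_sdiff, Finset.mem_erase] at hi
    exact ⟨hi.1.1, hi.2⟩
  have hl : ∀ i ∈ N, B u i ≠ 0 := fun i hi => hB _ _ (hmemN i hi).1.symm huA (hmemN i hi).2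
  have hd := hl j (hEN hj)
  let x : ι → F := fun i => B j i / (B u j * B u i)
  have hBx : ∀ s ∈ N, ∀ a ∈ N, B s a = B u s * B u a * (x a - x s) := by
    intro s hs a ha
    have := detForm_plucker (v ∘ c) (v u) (v j) (v a) (v s) hd
    change B u j * B s a = B u s * B j a - B u a * B j s at this
    have h1 := hl s hs
    have h2 := hl a ha
    simp only [x]
    field_simp
    linear_combination this
  have hx : Set.InjOn x N := by
    intro s hs a ha h
    by_contra hsa
    refine hB s a hsa (hmemN s hs).2 (hmemN a ha).2 ?_
    rw [hBx s hs a ha, h, sub_self, mul_zero]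
  have hsum := sum_prod_inv_eq_zero N E x (B u) hEN hx hl (by
    have := Finset.card_le_card hcS
    rw [Finset.card_erase_of_mem huS, hS, hAc] at this
    omega)
  rw [← hsum]
  refine Finset.sum_congr rfl fun a ha => ?_
  have haN := hEN ha
  have himg : Finset.univ.image (Matrix.vecCons a c) = insert a A := by
    ext y
    simp only [hA, Finset.mem_image, Finset.mem_univ, true_and, Finset.mem_insert,
      Fin.exists_fin_succ, Matrix.cons_val_zero, Matrix.cons_val_succ, eq_comm]
  have hsplit : ∀ T : Finset ι, u ∈ T →
      T \ insert a A = insert u ((T.erase u \ A).erase a) := by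
    intro T hT
    ext y
    have := (hmemN a haN).1
    simp only [Finset.mem_sdiff, Finset.mem_insert, Finset.mem_erase]
    grind
  have hua : u ∉ (N.erase a) := by simp [hN]
  have hua' : u ∉ (E.erase a) := by simp [hE]
  rw [scaledDetForm, himg, hsplit S huS, hsplit G hu, comp_vecCons]
  change ((∏ s ∈ insert u (N.erase a), B s a)⁻¹ * (∏ z ∈ insert u (E.erase a), B z a)⁻¹) *
    B u a = _
  rw [Finset.prod_insert hua, Finset.prod_insert hua',
    Finset.prod_congr rfl fun s hs => hBx s (Finset.mem_of_mem_erase hs) a haN,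
    Finset.prod_congr rfl fun s hs => hBx s (hEN (Finset.mem_of_mem_erase hs)) a haN]
  have := hl a haN
  simp only [mul_inv]
  field_simp

/-- In an `(n + 2)`-dimensional space with `n ≤ 2p - 4`, no set of `q + 2` vectors has all its
subsets of size `n + 2` linearly independent. -/
theorem card_le_of_det_ne_zero {ι F : Type*} [DecidableEq ι] [Field F] [Fintype F]
    [DecidableEq F] {p n : ℕ} (hp : p.Prime) [CharP F p] (hn : n + 4 ≤ 2 * p)
    (hq : 2 * (n + 1) ≤ Fintype.card F + 2) (v : ι → Fin (n + 2) → F)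
    (hv : ∀ c : Fin (n + 2) → ι, Function.Injective c →
      Matrix.detRowAlternating (R := F) (v ∘ c) ≠ 0) (S : Finset ι) :
    S.card ≤ Fintype.card F + 1 := by
  classical
  by_contra! hlt
  obtain ⟨S', -, hS⟩ := Finset.exists_subset_card_eq (s := S) (n := Fintype.card F + 2) hlt
  obtain ⟨G, hGS, hG⟩ := Finset.exists_subset_card_eq (s := S') (n := 2 * (n + 1)) (hS ▸ hq)
  let P : Finset ι → (Fin (n + 1) → ι) → Prop := fun K c =>
    Function.Injective c ∧ Finset.univ.image c = K ∧ K ⊆ G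
  let φ : Finset ι → (Fin (n + 2) → F) →ₗ[F] F := fun K =>
    if h : ∃ c, P K c then scaledDetForm v S' G h.choose else 0
  have hφ : ∀ K c, P K c → φ K = scaledDetForm v S' G c := by
    intro K c hc
    have hex : ∃ c, P K c := ⟨c, hc⟩
    simp only [φ, dif_pos hex]
    obtain ⟨hinj, himg, -⟩ := hex.choose_spec
    set c' := hex.choose
    have hmem : ∀ i, ∃ j, c j = c' i := fun i => by
      have : c' i ∈ Finset.univ.image c :=
        hc.2.1 ▸ himg ▸ Finset.mem_image_of_mem _ (Finset.mem_univ i)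
      simpa using this
    choose τ hτ using hmem
    have hτi : Function.Injective τ := fun i j h => hinj (by rw [← hτ, ← hτ, h])
    have hcc : c' = c ∘ Equiv.ofBijective τ (Finite.injective_iff_bijective.1 hτi) := by
      ext1 i
      exact (hτ i).symm
    rw [hcc]
    refine scaledDetForm_comp_perm v S' G hS hGS hG c hc.1 (fun i => ?_) _
    exact hc.2.2 (hc.2.1 ▸ Finset.mem_image_of_mem _ (Finset.mem_univ i))
  have henum : ∀ {m : ℕ} (K : Finset ι), K.card = m →
      ∃ c : Fin m → ι, Function.Injective c ∧ Finset.univ.image c = K := by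
    intro m K hK
    refine ⟨fun i => (K.equivFinOfCardEq hK).symm i,
      Subtype.val_injective.comp (Equiv.injective _), ?_⟩
    ext y
    simp only [Finset.mem_image, Finset.mem_univ, true_and]
    exact ⟨fun ⟨i, hi⟩ => hi ▸ Subtype.property _,
      fun hy => ⟨K.equivFinOfCardEq hK ⟨y, hy⟩, by simp⟩⟩
  let V : Submodule F (ι → F) := LinearMap.range
    (LinearMap.pi (fun i => LinearMap.applyₗ (R := F) (M₂ := F) (v i)))
  let w : Finset ι → ι → F := fun K i => φ K (v i)
  have hdet : ∀ (c : Fin (n + 1) → ι), Function.Injective c → ∀ u ∉ Finset.univ.image c,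
      detForm (v ∘ c) (v u) ≠ 0 := by
    intro c hc u hu
    have := hv (Matrix.vecCons u c) (by
      rw [Matrix.vecCons, Fin.cons_injective_iff]
      refine ⟨?_, hc⟩
      rintro ⟨i, hi⟩
      exact hu (Finset.mem_image.2 ⟨i, Finset.mem_univ _, hi⟩))
    rwa [comp_vecCons] at this
  obtain ⟨K, hKG, hKc⟩ := Finset.exists_subset_card_eq (s := G) (n := n + 1) (by omega)
  obtain ⟨u, hu⟩ : (G \ K).Nonempty := Finset.card_pos.1 (by
    rw [Finset.card_sdiff_of_subset hKG]
    omega)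
  rw [Finset.mem_sdiff] at hu
  have hKu : K ⊆ G.erase u := fun x hx =>
    Finset.mem_erase.2 ⟨fun h => hu.2 (h ▸ hx), hKG hx⟩
  have hzero : w K u = 0 := by
    refine eq_zero_of_sum_insert_apply_eq_zero hp (m := n + 1) (by omega) (by omega) V G hG
      ?_ w ?_ ?_ ?_ K u hu.1 hKu hKc
    · rintro _ ⟨ψ, rfl⟩ Z hZ hZc hψ
      obtain ⟨Z', hZZ, hZc'⟩ := Finset.exists_subset_card_eq hZc
      obtain ⟨c, hc, himg⟩ := henum Z' hZc'
      have hli : LinearIndependent F (v ∘ c) := by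
        have : IsUnit (Matrix.of (v ∘ c)) := by
          rw [Matrix.isUnit_iff_isUnit_det]
          exact isUnit_iff_ne_zero.2 (hv c hc)
        exact Matrix.linearIndependent_rows_iff_isUnit.2 this
      have hspan := hli.span_eq_top_of_card_eq_finrank' (by simp)
      have : ψ = 0 := LinearMap.ext_on_range hspan fun i =>
        hψ (c i) (hZZ (himg ▸ Finset.mem_image_of_mem _ (Finset.mem_univ i)))
      rw [this, map_zero]
    · exact fun K => ⟨φ K, rfl⟩
    · intro K i hi
      by_cases h : ∃ c, P K c
      · obtain ⟨c, hc⟩ := h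
        simp only [w, hφ K c hc]
        rw [← hc.2.1] at hi
        obtain ⟨j, -, rfl⟩ := Finset.mem_image.1 hi
        rw [scaledDetForm, LinearMap.smul_apply]
        exact smul_eq_zero_of_right _ (detForm_apply_eq_zero (v ∘ c) j)
      · simp only [w, φ, dif_neg h, LinearMap.zero_apply]
    · intro u hu A hA hAc
      obtain ⟨c, hc, rfl⟩ := henum A (Nat.succ_injective hAc)
      rw [← sum_scaledDetForm_eq_zero v hv S' G hS hGS hG c hc u hu hA]
      refine Finset.sum_congr rfl fun a ha => ?_
      simp only [Finset.mem_sdiff, Finset.mem_erase] at ha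
      simp only [w]
      rw [hφ _ (Matrix.vecCons a c)]
      refine ⟨?_, ?_, ?_⟩
      · rw [Matrix.vecCons, Fin.cons_injective_iff]
        refine ⟨?_, hc⟩
        rintro ⟨i, hi⟩
        exact ha.2 (Finset.mem_image.2 ⟨i, Finset.mem_univ _, hi⟩)
      · ext y
        simp only [Finset.mem_image, Finset.mem_univ, true_and, Finset.mem_insert,
          Fin.exists_fin_succ, Matrix.cons_val_zero, Matrix.cons_val_succ, eq_comm]
      · exact Finset.insert_subset ha.1.2 (hA.trans (Finset.erase_subset _ _))
  obtain ⟨c, hc, himg⟩ := henum K hKc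
  simp only [w, hφ K c ⟨hc, himg, hKG⟩, scaledDetForm, LinearMap.smul_apply, smul_eq_mul,
    himg, mul_eq_zero, inv_eq_zero, Finset.prod_eq_zero_iff] at hzero
  rw [← himg] at hzero hu
  rcases hzero with (⟨i, hi, h⟩ | ⟨i, hi, h⟩) | h
  · exact hdet c hc i (Finset.mem_sdiff.1 hi).2 h
  · exact hdet c hc i (Finset.mem_sdiff.1 hi).2 h
  · exact hdet c hc u hu.2 h

theorem detRowAlternating_ne_zero_of_card_zeros_lt {F : Type*} [Field F] {n k : ℕ}
    (C : Submodule F (Fin n → F)) (b : Module.Basis (Fin k) F C)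
    (hC : ∀ c ∈ C, ∀ f : Fin k → Fin n, Function.Injective f → (∀ i, c (f i) = 0) → c = 0)
    (f : Fin k → Fin n) (hf : Function.Injective f) :
    Matrix.detRowAlternating (R := F) ((fun i j => (b j : Fin n → F) i) ∘ f) ≠ 0 := by
  intro h
  obtain ⟨y, hy, hM⟩ := Matrix.exists_mulVec_eq_zero_iff.2 h
  have hsum := hC (∑ j, y j • b j : C) (Subtype.property _) f hf fun i => by
    have := congrFun hM i
    simp only [Matrix.mulVec, dotProduct, Function.comp_apply, Pi.zero_apply] at this
    simp only [Submodule.coe_sum, Submodule.coe_smul, Finset.sum_apply, Pi.smul_apply,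
      smul_eq_mul]
    rw [← this]
    exact Finset.sum_congr rfl fun j _ => mul_comm _ _
  refine hy (funext fun j => ?_)
  exact Fintype.linearIndependent_iff.1 b.linearIndependent y (Subtype.ext hsum) j

/-- let `p` be a prime, `h ≥ 2` (so `q = p^h` is not prime), and
`2 ≤ k ≤ 2p − 2`.  If `C` is a `k`-dimensional linear subspace of `𝔽_q^n` in which every
nonzero codeword has Hamming weight at least `n − k + 1` (an MDS code of length `n` and
dimension `k`), then `n ≤ q + 1`. -/
theorem statement14 (p h n k : ℕ) (hp : p.Prime) (hh : 2 ≤ h)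
    (F : Type) [Field F] [Fintype F] [DecidableEq F] (hF : Fintype.card F = p ^ h)
    (hk2 : 2 ≤ k) (hk : k ≤ 2 * p - 2)
    (C : Submodule F (Fin n → F)) (hdim : Module.finrank F C = k)
    (hMDS : ∀ c ∈ C, c ≠ 0 →
      n - k + 1 ≤ (Finset.univ.filter (fun i => c i ≠ 0)).card) :
    n ≤ p ^ h + 1 := by
  obtain ⟨l, rfl⟩ : ∃ l, k = l + 2 := ⟨k - 2, by omega⟩
  have : Fact p.Prime := ⟨hp⟩
  have : CharP F p := charP_of_card_eq_prime_pow hF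
  have hq : 2 * (l + 1) ≤ Fintype.card F + 2 := by
    rw [hF]
    have h1 : p ^ 2 ≤ p ^ h := Nat.pow_le_pow_right hp.pos hh
    have h2 : 4 * p ≤ p ^ 2 + 4 := by
      zify
      nlinarith [sq_nonneg ((p : ℤ) - 2)]
    omega
  have := card_le_of_det_ne_zero hp (by omega) hq _
    (detRowAlternating_ne_zero_of_card_zeros_lt C (Module.finBasisOfFinrankEq F C hdim) ?_)
    (Finset.univ : Finset (Fin n))
  · rwa [Finset.card_univ, Fintype.card_fin, hF] at this
  · intro c hc f hf hcf
    by_contra hne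
    have h1 := hMDS c hc hne
    have h2 : (Finset.univ.filter (fun i => c i ≠ 0)) ⊆ Finset.univ \ Finset.univ.image f := by
      intro i hi
      simp only [Finset.mem_filter, Finset.mem_univ, true_and, Finset.mem_sdiff,
        Finset.mem_image, not_exists] at hi ⊢
      exact fun j hj => hi (hj ▸ hcf j)
    have h3 := Finset.card_le_card h2
    rw [Finset.card_sdiff_of_subset (Finset.subset_univ _), Finset.card_image_of_injective _ hf,
      Finset.card_univ, Finset.card_univ, Fintype.card_fin, Fintype.card_fin] at h3
    omega
end
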